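/- arXiv:math/9903029 — 2 statements merged into one kernel-verified Lean document; each statement's English description precedes it below -/
import Mathlib

section
/- In any quadrangulation of a convex polygon with 2N+2 vertices colored alternately black and white (a subdivision of the polygon by pairwise non-crossing diagonals into N quadrilateral faces with all corners at vertices of the polygon), every quadrilateral face has exactly two black and two white corners, and opposite corners of each face have the same color. -/
noncomputable section

/-! Quadrangulations of a convex polygon.

The convex polygon `S` with `M = 2N+2` vertices is realized as the regular `M`-gon
inscribed in the unit circle, its vertices indexed by `ZMod M` in counterclockwise
(positively oriented) order.  Vertices are colored alternately: a vertex `j` is *black*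
when `j.val` is even and *white* otherwise.  A labeled quadrangulation is a family
`F : ZMod N → Finset (ZMod M)` of `N` quadruples of vertices (the corners of the faces,
indexed by their labels) whose convex hulls have pairwise disjoint interiors and
cover the polygon: this is exactly a subdivision of `S` by pairwise non-crossing
diagonals into `N` quadrilateral faces with all corners at vertices of `S`. -/

/-- The `j`-th vertex of the regular `M`-gon, in counterclockwise order. -/
def vtx (M : ℕ) (j : ZMod M) : ℂ :=
  Complex.exp (2 * Real.pi * Complex.I * (j.val : ℂ) / (M : ℂ))

/-- Vertex `j` is black (colors alternate around the polygon). -/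
def IsBlackV {M : ℕ} (j : ZMod M) : Prop := j.val % 2 = 0

/-- The (closed) quadrilateral with corners the vertices in `s`. -/
def hullOf (M : ℕ) (s : Finset (ZMod M)) : Set ℂ :=
  convexHull ℝ (vtx M '' (s : Set (ZMod M)))

/-- The (closed) polygon `S`: the convex hull of all of its vertices. -/
def polygonSet (M : ℕ) : Set ℂ :=
  convexHull ℝ (Set.range (vtx M))

/-- `F` is a labeled quadrangulation of the `(2N+2)`-gon: a subdivision of the polygon
into `N` quadrilateral faces (labeled by `ZMod N`), all corners at vertices, with
pairwise disjoint interiors, covering the polygon. -/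
def IsLQ (N : ℕ) (F : ZMod N → Finset (ZMod (2 * N + 2))) : Prop :=
  (∀ i, (F i).card = 4) ∧
  (∀ i j, i ≠ j →
    interior (hullOf (2 * N + 2) (F i)) ∩ interior (hullOf (2 * N + 2) (F j)) = ∅) ∧
  (⋃ i, hullOf (2 * N + 2) (F i)) = polygonSet (2 * N + 2)

/-- `x` and `y` are opposite corners of the face with corner set `s`:
the open diagonal between them passes through the interior of the face. -/
def OppCorner (M : ℕ) (s : Finset (ZMod M)) (x y : ZMod M) : Prop :=
  x ∈ s ∧ y ∈ s ∧ x ≠ y ∧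
    openSegment ℝ (vtx M x) (vtx M y) ⊆ interior (hullOf M s)

/-- `x` and `y` are endpoints of a side of the face with corner set `s`:
the open segment between them lies on the boundary of the face. -/
def SideOf (M : ℕ) (s : Finset (ZMod M)) (x y : ZMod M) : Prop :=
  x ∈ s ∧ y ∈ s ∧ x ≠ y ∧
    openSegment ℝ (vtx M x) (vtx M y) ⊆ frontier (hullOf M s)

/-- The counterclockwise distance from the vertex `w` to the nearest corner of the
face `s` other than `w`; comparing these values orders the faces incident to `w`
in the counterclockwise (positively oriented) fan around `w`. -/
def ccwMin (M : ℕ) (w : ZMod M) (s : Finset (ZMod M)) : WithTop ℕ :=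
  ((s.erase w).image fun x => (x - w).val).min

/-- The labeled quadrangulation `F` is monotone: for every white vertex `w` the
counterclockwise (positive) order of the faces incident to `w` agrees with the
increasing order of their labels, and for every black vertex it agrees with the
decreasing order of their labels. -/
def IsMonotoneQ (N : ℕ) (F : ZMod N → Finset (ZMod (2 * N + 2))) : Prop :=
  ∀ w : ZMod (2 * N + 2), ∀ i j : ZMod N, w ∈ F i → w ∈ F j → i ≠ j →
    (¬ IsBlackV w →
      (i.val < j.val ↔ ccwMin (2 * N + 2) w (F i) < ccwMin (2 * N + 2) w (F j))) ∧
    (IsBlackV w →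
      (i.val < j.val ↔ ccwMin (2 * N + 2) w (F j) < ccwMin (2 * N + 2) w (F i)))

/-- A monotone labeled quadrangulation. -/
def IsMLQ (N : ℕ) (F : ZMod N → Finset (ZMod (2 * N + 2))) : Prop :=
  IsLQ N F ∧ IsMonotoneQ N F

/-- Twice the signed area of the triangle `a b z`. -/
def cross (a b z : ℂ) : ℝ :=
  (b.re - a.re) * (z.im - a.im) - (b.im - a.im) * (z.re - a.re)

theorem cross_rotate (a b c : ℂ) : cross b c a = cross a b c := by
  unfold cross; ring

theorem cross_swap (a b c : ℂ) : cross b a c = -cross a b c := by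
  unfold cross; ring

theorem cross_flip (a b c : ℂ) : cross a b c = -cross a c b := by
  unfold cross; ring

theorem cross_self_left (a b : ℂ) : cross a b a = 0 := by
  unfold cross; ring

theorem cross_self_right (a b : ℂ) : cross a b b = 0 := by
  unfold cross; ring

theorem cross_lineMap (a b p q : ℂ) (t : ℝ) :
    cross a b (AffineMap.lineMap p q t) = (1 - t) * cross a b p + t * cross a b q := by
  simp only [cross, AffineMap.lineMap_apply_module, Complex.add_re, Complex.add_im,
    Complex.real_smul, Complex.mul_re, Complex.mul_im, Complex.ofReal_re, Complex.ofReal_im]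
  ring

theorem cross_midpoint (a b p q : ℂ) :
    cross a b (midpoint ℝ p q) = (cross a b p + cross a b q) / 2 := by
  rw [midpoint, cross_lineMap, invOf_eq_inv]
  ring

theorem continuous_cross (a b : ℂ) : Continuous (cross a b) := by
  unfold cross; fun_prop

theorem convex_cross_nonpos (a b : ℂ) : Convex ℝ {z | cross a b z ≤ 0} := by
  rw [convex_iff_segment_subset]
  intro p hp q hq z hz
  rw [segment_eq_image_lineMap] at hz
  obtain ⟨t, ⟨h0, h1⟩, rfl⟩ := hz
  simp only [Set.mem_ofPred_eq] at *
  rw [cross_lineMap]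
  nlinarith

/-- A point with positive barycentric coordinates is interior to a triangle. -/
theorem mem_interior_of_cross_pos {S : Set ℂ} (hS : Convex ℝ S) {a b c z : ℂ}
    (ha : a ∈ S) (hb : b ∈ S) (hc : c ∈ S) (habc : 0 < cross a b c)
    (h1 : 0 < cross b c z) (h2 : 0 < cross c a z) (h3 : 0 < cross a b z) :
    z ∈ interior S := by
  rw [mem_interior]
  refine ⟨{w | 0 < cross b c w} ∩ {w | 0 < cross c a w} ∩ {w | 0 < cross a b w}, ?_, ?_,
    ⟨⟨h1, h2⟩, h3⟩⟩
  · rintro w ⟨⟨h1, h2⟩, h3⟩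
    simp only [Set.mem_ofPred_eq] at h1 h2 h3
    have hsum : cross b c w + cross c a w + cross a b w = cross a b c := by
      unfold cross; ring
    have key := hS.sum_mem (t := Finset.univ)
      (w := ![cross b c w / cross a b c, cross c a w / cross a b c, cross a b w / cross a b c])
      (z := ![a, b, c]) ?_ ?_ ?_
    · convert key using 1
      have hne := habc.ne'
      simp only [Fin.sum_univ_three, Matrix.cons_val_zero, Matrix.cons_val_one,
        Matrix.cons_val]
      apply Complex.ext
      · simp only [Complex.add_re, Complex.real_smul, Complex.re_ofReal_mul]
        field_simp
        unfold cross; ring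
      · simp only [Complex.add_im, Complex.real_smul, Complex.im_ofReal_mul]
        field_simp
        unfold cross; ring
    · intro i _
      fin_cases i <;> simp <;> positivity
    · simp only [Fin.sum_univ_three, Matrix.cons_val_zero, Matrix.cons_val_one,
        Matrix.cons_val]
      rw [← add_div, ← add_div, hsum, div_self habc.ne']
    · intro i _
      fin_cases i <;> simpa
  · exact ((isOpen_lt continuous_const (continuous_cross b c)).inter
      (isOpen_lt continuous_const (continuous_cross c a))).inter
      (isOpen_lt continuous_const (continuous_cross a b))

/-- Moving from the midpoint of a side of a triangle to a point on the same side of that line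
enters the interior. -/
theorem eventually_lineMap_mem_interior {S : Set ℂ} (hS : Convex ℝ S) {a b c q : ℂ}
    (ha : a ∈ S) (hb : b ∈ S) (hc : c ∈ S) (habc : 0 < cross a b c) (hq : 0 < cross a b q) :
    ∀ᶠ t : ℝ in nhdsWithin 0 (Set.Ioi 0),
      AffineMap.lineMap (midpoint ℝ a b) q t ∈ interior S := by
  have key (u w : ℂ) (h : 0 < cross u w (midpoint ℝ a b)) :
      ∀ᶠ t : ℝ in nhdsWithin 0 (Set.Ioi 0),
        0 < cross u w (AffineMap.lineMap (midpoint ℝ a b) q t) := by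
    have hcont : Continuous fun t : ℝ =>
        cross u w (AffineMap.lineMap (midpoint ℝ a b) q t) :=
      (continuous_cross u w).comp AffineMap.lineMap_continuous
    refine nhdsWithin_le_nhds (hcont.continuousAt.eventually_const_lt ?_)
    simpa using h
  have h1 : 0 < cross b c (midpoint ℝ a b) := by
    rw [cross_midpoint, cross_rotate, cross_self_left]; linarith
  have h2 : 0 < cross c a (midpoint ℝ a b) := by
    rw [cross_midpoint, cross_self_right, cross_rotate, cross_rotate]; linarith
  filter_upwards [key b c h1, key c a h2, self_mem_nhdsWithin] with t ht1 ht2 ht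
  refine mem_interior_of_cross_pos hS ha hb hc habc ht1 ht2 ?_
  rw [cross_lineMap, cross_midpoint, cross_self_left, cross_self_right]
  have : 0 < t := ht
  simpa using mul_pos this hq

/-- A convex set on one side of a line, but not contained in it, has no interior point on it. -/
theorem notMem_interior_of_cross_nonpos {S : Set ℂ} {a b c p : ℂ}
    (hS : ∀ z ∈ S, cross a b z ≤ 0) (hc : cross a b c < 0) (hp : cross a b p = 0) :
    p ∉ interior S := by
  intro h
  have hcont : Continuous fun t : ℝ => AffineMap.lineMap (k := ℝ) p c t :=
    AffineMap.lineMap_continuous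
  have h0 : ∀ᶠ t : ℝ in nhds 0, AffineMap.lineMap p c t ∈ interior S :=
    hcont.continuousAt.eventually_mem (isOpen_interior.mem_nhds (by simpa using h))
  have h1 : ∀ᶠ t : ℝ in nhdsWithin 0 (Set.Iio 0), AffineMap.lineMap p c t ∈ interior S :=
    nhdsWithin_le_nhds h0
  obtain ⟨t, ht, ht0⟩ := (h1.and self_mem_nhdsWithin).exists
  have := hS _ (interior_subset ht)
  rw [cross_lineMap, hp] at this
  have ht0 : t < 0 := ht0
  nlinarith

section Vertices

variable {M : ℕ}

theorem sin_pi_mul_div_pos {x : ℝ} (h0 : 0 < x) (h1 : x < M) :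
    0 < Real.sin (Real.pi * x / M) := by
  have hM : (0 : ℝ) < M := h0.trans h1
  apply Real.sin_pos_of_pos_of_lt_pi
  · have := Real.pi_pos
    positivity
  · rw [div_lt_iff₀ hM]
    exact mul_lt_mul_of_pos_left h1 Real.pi_pos

theorem vtx_mem_hullOf {s : Finset (ZMod M)} {x : ZMod M} (hx : x ∈ s) :
    vtx M x ∈ hullOf M s :=
  subset_convexHull ℝ _ ⟨x, hx, rfl⟩

theorem convex_hullOf (s : Finset (ZMod M)) : Convex ℝ (hullOf M s) :=
  convex_convexHull ℝ _

theorem isClosed_hullOf (s : Finset (ZMod M)) : IsClosed (hullOf M s) :=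
  Set.Finite.isClosed_convexHull ℝ (s.finite_toSet.image _)

theorem cross_nonpos_of_mem_hullOf {s : Finset (ZMod M)} {u w : ℂ}
    (h : ∀ c ∈ s, cross u w (vtx M c) ≤ 0) : ∀ z ∈ hullOf M s, cross u w z ≤ 0 := by
  refine convexHull_min ?_ (convex_cross_nonpos u w)
  rintro _ ⟨c, hc, rfl⟩
  exact h c hc

variable [NeZero M]

theorem vtx_natCast (n : ℕ) :
    vtx M (n : ZMod M) = Complex.exp ((2 * Real.pi * n / M : ℝ) * Complex.I) := by
  have hM : (M : ℂ) ≠ 0 := Nat.cast_ne_zero.2 (NeZero.ne M)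
  rw [vtx, ZMod.val_natCast]
  have h : ((2 * Real.pi * n / M : ℝ) : ℂ) * Complex.I =
      2 * Real.pi * Complex.I * ((n % M : ℕ) : ℂ) / M +
        ((n / M : ℕ) : ℂ) * (2 * Real.pi * Complex.I) := by
    have hn : (n : ℂ) = ((n % M : ℕ) : ℂ) + M * ((n / M : ℕ) : ℂ) := by
      exact_mod_cast (Nat.mod_add_div n M).symm
    push_cast
    rw [hn]
    field_simp
  rw [h, Complex.exp_periodic.nat_mul]

theorem vtx_re_im (a c : ZMod M) :
    (vtx M c).re = Real.cos (2 * Real.pi * a.val / M + 2 * Real.pi * (c - a).val / M) ∧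
    (vtx M c).im = Real.sin (2 * Real.pi * a.val / M + 2 * Real.pi * (c - a).val / M) := by
  have hc : c = ((a.val + (c - a).val : ℕ) : ZMod M) := by simp
  have h : 2 * Real.pi * a.val / M + 2 * Real.pi * (c - a).val / M =
      2 * Real.pi * ((a.val + (c - a).val : ℕ) : ℝ) / M := by push_cast; ring
  rw [h]
  constructor
  · conv_lhs => rw [hc, vtx_natCast, Complex.exp_ofReal_mul_I_re]
  · conv_lhs => rw [hc, vtx_natCast, Complex.exp_ofReal_mul_I_im]

theorem cross_vtx (a b c : ZMod M) :
    cross (vtx M a) (vtx M b) (vtx M c) =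
      4 * Real.sin (Real.pi * (b - a).val / M) * Real.sin (Real.pi * (c - a).val / M) *
        Real.sin (Real.pi * ((c - a).val - (b - a).val : ℝ) / M) := by
  obtain ⟨ar, ai⟩ := vtx_re_im a a
  obtain ⟨br, bi⟩ := vtx_re_im a b
  obtain ⟨cr, ci⟩ := vtx_re_im a c
  rw [cross, ar, ai, br, bi, cr, ci, Real.cos_sub_cos, Real.cos_sub_cos, Real.sin_sub_sin,
    Real.sin_sub_sin]
  simp only [sub_self, ZMod.val_zero, Nat.cast_zero, mul_zero, zero_div, add_zero]
  set α : ℝ := 2 * Real.pi * a.val / M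
  set σ : ℝ := Real.pi * (b - a).val / M with hσ
  set τ : ℝ := Real.pi * (c - a).val / M with hτ
  rw [show 2 * Real.pi * (b - a).val / M = 2 * σ by rw [hσ]; ring,
    show 2 * Real.pi * (c - a).val / M = 2 * τ by rw [hτ]; ring,
    show Real.pi * ((c - a).val - (b - a).val : ℝ) / M = (α + τ) - (α + σ) by
      rw [hσ, hτ]; ring, Real.sin_sub,
    show (α + 2 * σ + α) / 2 = α + σ by ring, show (α + 2 * σ - α) / 2 = σ by ring,
    show (α + 2 * τ + α) / 2 = α + τ by ring, show (α + 2 * τ - α) / 2 = τ by ring]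
  ring

theorem cross_vtx_pos {a b c : ZMod M} (h0 : 0 < (b - a).val)
    (h : (b - a).val < (c - a).val) : 0 < cross (vtx M a) (vtx M b) (vtx M c) := by
  rw [cross_vtx]
  have hb : ((b - a).val : ℝ) < M := by exact_mod_cast ZMod.val_lt _
  have hc : ((c - a).val : ℝ) < M := by exact_mod_cast ZMod.val_lt _
  have h0 : (0 : ℝ) < (b - a).val := by exact_mod_cast h0
  have h : ((b - a).val : ℝ) < (c - a).val := by exact_mod_cast h
  have h1 := sin_pi_mul_div_pos h0 hb
  have h2 := sin_pi_mul_div_pos (h0.trans h) hc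
  have h3 := sin_pi_mul_div_pos (M := M) (sub_pos.2 h) (by linarith)
  positivity

theorem cross_vtx_neg {a b c : ZMod M} (h0 : 0 < (c - a).val)
    (h : (c - a).val < (b - a).val) : cross (vtx M a) (vtx M b) (vtx M c) < 0 := by
  rw [cross_flip]
  exact neg_neg_of_pos (cross_vtx_pos h0 h)

theorem cross_vtx_nonneg {a b c : ZMod M} (h : c = a ∨ (b - a).val ≤ (c - a).val) :
    0 ≤ cross (vtx M a) (vtx M b) (vtx M c) := by
  rcases h with rfl | h
  · rw [cross_self_left]
  rcases Nat.eq_zero_or_pos (b - a).val with h0 | h0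
  · rw [cross_vtx, h0]; simp
  rcases h.eq_or_lt with h | h
  · rw [cross_vtx, h]; simp
  · exact (cross_vtx_pos h0 h).le

theorem cross_vtx_nonpos {a b c : ZMod M} (h : (c - a).val ≤ (b - a).val) :
    cross (vtx M a) (vtx M b) (vtx M c) ≤ 0 := by
  rcases Nat.eq_zero_or_pos (c - a).val with h0 | h0
  · rw [cross_vtx, h0]; simp
  rcases h.eq_or_lt with h | h
  · rw [cross_vtx, h]; simp
  · exact (cross_vtx_neg h0 h).le

theorem val_sub_eq (a x y : ZMod M) :
    (x - a).val ≤ (y - a).val ∧ (y - x).val = (y - a).val - (x - a).val ∨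
    (y - a).val < (x - a).val ∧ (y - x).val = M + (y - a).val - (x - a).val := by
  have hx := ZMod.val_lt (x - a)
  rcases le_or_gt (x - a).val (y - a).val with h | h
  · left
    refine ⟨h, ?_⟩
    rw [← ZMod.val_sub h, sub_sub_sub_cancel_right]
  · right
    refine ⟨h, ?_⟩
    have h1 : (x - y).val = (x - a).val - (y - a).val := by
      rw [← ZMod.val_sub h.le, sub_sub_sub_cancel_right]
    have h2 : x - y ≠ 0 := by
      intro h0
      rw [h0, ZMod.val_zero] at h1
      omega
    have : NeZero (x - y) := ⟨h2⟩
    rw [← neg_sub x y, ZMod.val_neg_of_ne_zero, h1]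
    omega

theorem odd_val_sub_iff (hM : Even M) (a x : ZMod M) :
    Odd (x - a).val ↔ x.val % 2 ≠ a.val % 2 := by
  have h := val_sub_eq 0 a x
  simp only [sub_zero] at h
  have hx := ZMod.val_lt x
  have ha := ZMod.val_lt a
  obtain ⟨m, hm⟩ := hM
  rw [Nat.odd_iff]
  omega

/-- The corners of a quadrilateral in counterclockwise order starting from a given one. -/
theorem exists_corners {s : Finset (ZMod M)} (hs : s.card = 4) {a : ZMod M} (ha : a ∈ s) :
    ∃ x y z, s = {a, x, y, z} ∧ 0 < (x - a).val ∧ (x - a).val < (y - a).val ∧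
      (y - a).val < (z - a).val := by
  have hinj : Function.Injective fun x : ZMod M => (x - a).val := fun x y h =>
    sub_left_injective (ZMod.val_injective M h)
  have hcard : (s.erase a).card = 3 := by rw [Finset.card_erase_of_mem ha, hs]
  have hpos (x : ZMod M) (hx : x ≠ a) : 0 < (x - a).val := by
    rw [Nat.pos_iff_ne_zero, Ne, ZMod.val_eq_zero, sub_eq_zero]
    exact hx
  obtain ⟨x, y, z, hxy, hxz, hyz, h⟩ := Finset.card_eq_three.1 hcard
  have hs' : s = {a, x, y, z} := by rw [← Finset.insert_erase ha, h]
  have hmem (c : ZMod M) (hc : c ∈ ({x, y, z} : Finset (ZMod M))) : 0 < (c - a).val :=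
    hpos c (Finset.ne_of_mem_erase (h ▸ hc))
  have hx := hmem x (by simp)
  have hy := hmem y (by simp)
  have hz := hmem z (by simp)
  have hxy := hinj.ne hxy
  have hxz := hinj.ne hxz
  have hyz := hinj.ne hyz
  rcases lt_or_gt_of_ne hxy with h1 | h1 <;> rcases lt_or_gt_of_ne hxz with h2 | h2 <;>
    rcases lt_or_gt_of_ne hyz with h3 | h3
  · exact ⟨x, y, z, hs', hx, h1, h3⟩
  · exact ⟨x, z, y, by rw [hs']; grind, hx, h2, h3⟩
  · omega
  · exact ⟨z, x, y, by rw [hs']; grind, hz, h2, h1⟩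
  · exact ⟨y, x, z, by rw [hs']; grind, hy, h1, h2⟩
  · omega
  · exact ⟨y, z, x, by rw [hs']; grind, hy, h3, h2⟩
  · exact ⟨z, y, x, by rw [hs']; grind, hz, h3, h1⟩

theorem interior_hullOf_nonempty {s : Finset (ZMod M)} (hs : s.card = 4) :
    (interior (hullOf M s)).Nonempty := by
  obtain ⟨a, ha⟩ : s.Nonempty := Finset.card_pos.1 (by omega)
  obtain ⟨x, y, z, h, h0, h1, -⟩ := exists_corners hs ha
  have hpos := cross_vtx_pos h0 h1
  obtain ⟨t, ht⟩ := (eventually_lineMap_mem_interior (convex_hullOf s) (vtx_mem_hullOf ha)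
    (vtx_mem_hullOf (x := x) (by simp [h])) (vtx_mem_hullOf (x := y) (by simp [h]))
    hpos hpos).exists
  exact ⟨_, ht⟩

theorem disjoint_interior_hullOf {s t : Finset (ZMod M)} (ht : t.card = 4)
    (h : interior (hullOf M s) ∩ interior (hullOf M t) = ∅) :
    Disjoint (interior (hullOf M s)) (hullOf M t) := by
  have := (Set.disjoint_iff_inter_eq_empty.2 h).closure_right isOpen_interior
  rwa [(convex_hullOf t).closure_interior_eq_closure_of_nonempty_interior
    (interior_hullOf_nonempty ht), (isClosed_hullOf t).closure_eq] at this

/-- The ordered pair `a, b` spans a side of `s`, and `s` lies to its left. -/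
def IsSide (s : Finset (ZMod M)) (a b : ZMod M) : Prop :=
  a ∈ s ∧ b ∈ s ∧ a ≠ b ∧ ∀ c ∈ s, c = a ∨ (b - a).val ≤ (c - a).val

theorem isSide_of_corners {s : Finset (ZMod M)} {a x y z : ZMod M} (hs : s = {a, x, y, z})
    (h0 : 0 < (x - a).val) (h1 : (x - a).val < (y - a).val) (h2 : (y - a).val < (z - a).val) :
    IsSide s a x ∧ IsSide s x y ∧ IsSide s y z := by
  have ne (u v : ZMod M) (h : (u - a).val < (v - a).val) : u ≠ v := by
    rintro rfl; omega
  have hz := ZMod.val_lt (z - a)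
  have haa : (a - a).val = 0 := by simp
  refine ⟨⟨by simp [hs], by simp [hs], ne _ _ (by omega), ?_⟩,
    ⟨by simp [hs], by simp [hs], ne _ _ h1, ?_⟩, ⟨by simp [hs], by simp [hs], ne _ _ h2, ?_⟩⟩
  · intro c hc
    simp only [hs, Finset.mem_insert, Finset.mem_singleton] at hc
    rcases hc with rfl | rfl | rfl | rfl
    · exact .inl rfl
    all_goals right; omega
  · intro c hc
    have hxy := val_sub_eq a x y
    have hxc := val_sub_eq a x c
    simp only [hs, Finset.mem_insert, Finset.mem_singleton] at hc
    rcases hc with rfl | rfl | rfl | rfl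
    · right; omega
    · exact .inl rfl
    all_goals right; omega
  · intro c hc
    have hyz := val_sub_eq a y z
    have hyc := val_sub_eq a y c
    simp only [hs, Finset.mem_insert, Finset.mem_singleton] at hc
    rcases hc with rfl | rfl | rfl | rfl
    · right; omega
    · right; omega
    · exact .inl rfl
    · right; omega

theorem IsSide.exists_cross_pos {s : Finset (ZMod M)} {a b : ZMod M} (h : IsSide s a b)
    (hs : s.card = 4) : ∃ c ∈ s, 0 < cross (vtx M a) (vtx M b) (vtx M c) := by
  obtain ⟨ha, hb, hab, hside⟩ := h
  obtain ⟨x, y, z, hxyz, h0, h1, h2⟩ := exists_corners hs ha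
  refine ⟨z, by simp [hxyz], cross_vtx_pos ?_ ?_⟩
  · rw [Nat.pos_iff_ne_zero, Ne, ZMod.val_eq_zero, sub_eq_zero]
    exact hab.symm
  · rcases hside x (by simp [hxyz]) with rfl | h
    · simp at h0
    · omega

end Vertices

/-- Across a side of a face that is not an edge of the polygon there is another face. -/
theorem exists_face_across {N : ℕ} [NeZero N] {F : ZMod N → Finset (ZMod (2 * N + 2))}
    (hF : IsLQ N F) {i : ZMod N} {a b : ZMod (2 * N + 2)} (h : IsSide (F i) a b)
    (hk : 1 < (b - a).val) :
    ∃ j, a ∈ F j ∧ b ∈ F j ∧ ∀ c ∈ F j, (c - a).val ≤ (b - a).val := by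
  obtain ⟨hcard, hdisj, hcover⟩ := hF
  have hlt := ZMod.val_lt (b - a)
  have hone : (1 : ZMod (2 * N + 2)).val = 1 := ZMod.val_one'' (by omega)
  set p := midpoint ℝ (vtx (2 * N + 2) a) (vtx (2 * N + 2) b) with hp
  set d := a + 1 with hd
  have hda : (d - a).val = 1 := by rw [hd, add_sub_cancel_left, hone]
  have hdneg : cross (vtx _ a) (vtx _ b) (vtx _ d) < 0 :=
    cross_vtx_neg (by omega) (by omega)
  have hp0 : cross (vtx _ a) (vtx _ b) p = 0 := by
    rw [hp, cross_midpoint, cross_self_left, cross_self_right]; simp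
  obtain ⟨j, hj⟩ : ∃ j, ∃ᶠ t : ℝ in nhdsWithin 0 (Set.Ioi 0),
      AffineMap.lineMap p (vtx _ d) t ∈ hullOf (2 * N + 2) (F j) := by
    by_contra! hcon
    have hlt1 : ∀ᶠ t : ℝ in nhdsWithin 0 (Set.Ioi 0), t < 1 :=
      nhdsWithin_le_nhds (eventually_lt_nhds one_pos)
    obtain ⟨t, ⟨hnot, ht1⟩, ht0⟩ :=
      (((Filter.eventually_all.2 hcon).and hlt1).and self_mem_nhdsWithin).exists
    have hmem : AffineMap.lineMap p (vtx _ d) t ∈ polygonSet (2 * N + 2) := by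
      have hconv : Convex ℝ (polygonSet (2 * N + 2)) := convex_convexHull ℝ _
      have hv (x) : vtx (2 * N + 2) x ∈ polygonSet (2 * N + 2) :=
        subset_convexHull ℝ _ ⟨x, rfl⟩
      exact hconv.lineMap_mem (hconv.midpoint_mem (hv a) (hv b)) (hv d) ⟨le_of_lt ht0, ht1.le⟩
    rw [← hcover, Set.mem_iUnion] at hmem
    obtain ⟨j, hj⟩ := hmem
    exact hnot j hj
  have hpj : p ∈ hullOf (2 * N + 2) (F j) := by
    refine (isClosed_hullOf (F j)).mem_of_frequently_of_tendsto hj ?_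
    have hcont : Continuous fun t : ℝ => AffineMap.lineMap (k := ℝ) p (vtx (2 * N + 2) d) t :=
      AffineMap.lineMap_continuous
    have := hcont.tendsto 0
    simp only [AffineMap.lineMap_apply_zero] at this
    exact this.mono_left nhdsWithin_le_nhds
  have hij : i ≠ j := by
    rintro rfl
    obtain ⟨t, ht, ht0⟩ := (hj.and_eventually self_mem_nhdsWithin).exists
    have hside : ∀ c ∈ F i, cross (vtx _ b) (vtx _ a) (vtx _ c) ≤ 0 := by
      intro c hc
      rw [cross_swap]
      linarith [cross_vtx_nonneg (h.2.2.2 c hc)]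
    have := cross_nonpos_of_mem_hullOf hside _ ht
    rw [cross_swap, cross_lineMap, hp0] at this
    have ht0 : 0 < t := ht0
    nlinarith
  have hle : ∀ c ∈ F j, (c - a).val ≤ (b - a).val := by
    intro c hc
    by_contra! hgt
    have hcpos := cross_vtx_pos (by omega) hgt
    obtain ⟨e, he, hepos⟩ := h.exists_cross_pos (hcard i)
    have hlt1 : ∀ᶠ t : ℝ in nhdsWithin 0 (Set.Ioi 0), t < 1 :=
      nhdsWithin_le_nhds (eventually_lt_nhds one_pos)
    obtain ⟨t, ⟨htint, ht1⟩, ht0⟩ := (((eventually_lineMap_mem_interior (convex_hullOf (F i))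
      (vtx_mem_hullOf h.1) (vtx_mem_hullOf h.2.1) (vtx_mem_hullOf he) hepos hcpos).and
      hlt1).and self_mem_nhdsWithin).exists
    exact (disjoint_interior_hullOf (hcard j) (hdisj i j hij)).notMem_of_mem_left htint
      ((convex_hullOf (F j)).lineMap_mem hpj (vtx_mem_hullOf hc) ⟨le_of_lt ht0, ht1.le⟩)
  have hbd := val_sub_eq a d b
  refine ⟨j, ?_, ?_, hle⟩
  · by_contra ha
    have hside : ∀ c ∈ F j, cross (vtx _ d) (vtx _ b) (vtx _ c) ≤ 0 := by
      intro c hc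
      apply cross_vtx_nonpos
      have hca : 0 < (c - a).val := by
        rw [Nat.pos_iff_ne_zero, Ne, ZMod.val_eq_zero, sub_eq_zero]
        rintro rfl
        exact ha hc
      have := hle c hc
      have hcd := val_sub_eq a d c
      omega
    have := cross_nonpos_of_mem_hullOf hside _ hpj
    rw [hp, cross_midpoint, cross_self_right, cross_rotate] at this
    have := cross_vtx_pos (a := a) (b := d) (c := b) (by omega) (by omega)
    linarith
  · by_contra hb
    set e := b - 1 with he
    have hea : (e - a).val = (b - a).val - 1 := by
      rw [he, sub_right_comm, ZMod.val_sub (by omega), hone]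
    have hside : ∀ c ∈ F j, cross (vtx _ a) (vtx _ e) (vtx _ c) ≤ 0 := by
      intro c hc
      apply cross_vtx_nonpos
      have hne : (c - a).val ≠ (b - a).val := by
        intro h
        exact hb (sub_left_injective (ZMod.val_injective _ h) ▸ hc)
      have := hle c hc
      omega
    have := cross_nonpos_of_mem_hullOf hside _ hpj
    rw [hp, cross_midpoint, cross_self_left] at this
    have := cross_vtx_pos (a := a) (b := e) (c := b) (by omega) (by omega)
    linarith

theorem IsSide.odd {N : ℕ} [NeZero N] {F : ZMod N → Finset (ZMod (2 * N + 2))}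
    (hF : IsLQ N F) {i : ZMod N} {a b : ZMod (2 * N + 2)} (h : IsSide (F i) a b) :
    Odd (b - a).val := by
  induction hk : (b - a).val using Nat.strong_induction_on generalizing i a b with
  | _ k ih =>
    subst hk
    have hpos : 0 < (b - a).val := by
      rw [Nat.pos_iff_ne_zero, Ne, ZMod.val_eq_zero, sub_eq_zero]
      exact h.2.2.1.symm
    rcases Nat.lt_or_ge 1 (b - a).val with hk | hk
    · obtain ⟨j, ha, hb, hle⟩ := exists_face_across hF h hk
      obtain ⟨x, y, z, hxyz, h0, h1, h2⟩ := exists_corners (hF.1 j) ha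
      obtain rfl : b = z := by
        have := hle z (by simp [hxyz])
        simp only [hxyz, Finset.mem_insert, Finset.mem_singleton] at hb
        rcases hb with rfl | rfl | rfl | rfl
        · simp at hpos
        · omega
        · omega
        · rfl
      obtain ⟨hax, hxy, hyb⟩ := isSide_of_corners hxyz h0 h1 h2
      have exy := val_sub_eq a x y
      have eyb := val_sub_eq a y b
      have o1 := ih _ (by omega) hax rfl
      have o2 := ih _ (by omega) hxy rfl
      have o3 := ih _ (by omega) hyb rfl
      rw [Nat.odd_iff] at *
      omega
    · rw [Nat.odd_iff]
      omega

/-- The corners of a face, in counterclockwise order, alternate in color. -/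
theorem exists_alternating_corners {N : ℕ} [NeZero N] {F : ZMod N → Finset (ZMod (2 * N + 2))}
    (hF : IsLQ N F) {i : ZMod N} {a : ZMod (2 * N + 2)} (ha : a ∈ F i) :
    ∃ x y z, F i = {a, x, y, z} ∧ 0 < (x - a).val ∧ (x - a).val < (y - a).val ∧
      (y - a).val < (z - a).val ∧ x.val % 2 ≠ a.val % 2 ∧ y.val % 2 ≠ x.val % 2 ∧
      z.val % 2 ≠ y.val % 2 := by
  obtain ⟨x, y, z, hxyz, h0, h1, h2⟩ := exists_corners (hF.1 i) ha
  obtain ⟨hax, hxy, hyz⟩ := isSide_of_corners hxyz h0 h1 h2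
  have hM : Even (2 * N + 2) := ⟨N + 1, by ring⟩
  exact ⟨x, y, z, hxyz, h0, h1, h2, (odd_val_sub_iff hM _ _).1 (hax.odd hF),
    (odd_val_sub_iff hM _ _).1 (hxy.odd hF), (odd_val_sub_iff hM _ _).1 (hyz.odd hF)⟩

/-- Opposite corners of a face are separated by the other two corners. -/
theorem OppCorner.not_one_sided {M : ℕ} [NeZero M] {s : Finset (ZMod M)} {x y u w c : ZMod M}
    (h : OppCorner M s x y) (huw : u = x ∧ w = y ∨ u = y ∧ w = x)
    (hside : ∀ e ∈ s, cross (vtx M u) (vtx M w) (vtx M e) ≤ 0) :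
    ¬ cross (vtx M u) (vtx M w) (vtx M c) < 0 := by
  intro hc
  refine notMem_interior_of_cross_nonpos (p := midpoint ℝ (vtx M x) (vtx M y))
    (cross_nonpos_of_mem_hullOf hside) hc ?_ (h.2.2.2 ?_)
  · rcases huw with ⟨rfl, rfl⟩ | ⟨rfl, rfl⟩ <;>
      simp [cross_midpoint, cross_self_left, cross_self_right]
  · rw [openSegment_eq_image_lineMap]
    exact ⟨⅟2, by norm_num, rfl⟩

/-- in any quadrangulation of a convex polygon with `2N+2` vertices colored
alternately black and white, every quadrilateral face has exactly two black and two white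
corners, and opposite corners of each face have the same color. -/
theorem stmt_9 (N : ℕ) (hN : 1 ≤ N) (F : ZMod N → Finset (ZMod (2 * N + 2)))
    (hF : IsLQ N F) :
    ∀ i : ZMod N,
      ((F i).filter fun x => x.val % 2 = 0).card = 2 ∧
      ((F i).filter fun x => ¬ x.val % 2 = 0).card = 2 ∧
      (∀ x y : ZMod (2 * N + 2), OppCorner (2 * N + 2) (F i) x y →
        (IsBlackV x ↔ IsBlackV y)) := by
  have : NeZero N := ⟨by omega⟩
  intro i
  obtain ⟨a, ha⟩ : (F i).Nonempty := Finset.card_pos.1 (by rw [hF.1 i]; omega)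
  obtain ⟨x, y, z, hs, h0, h1, h2, hx, hy, hz⟩ := exists_alternating_corners hF ha
  have hay : a ≠ y := by
    rintro rfl
    simp at h1
  have hxz : x ≠ z := by
    rintro rfl
    omega
  rw [← and_assoc]
  refine ⟨?_, ?_⟩
  · rcases Nat.mod_two_eq_zero_or_one a.val with h | h
    · have hx : x.val % 2 = 1 := by omega
      have hy : y.val % 2 = 0 := by omega
      have hz : z.val % 2 = 1 := by omega
      simp [hs, Finset.filter_insert, Finset.filter_singleton, h, hx, hy, hz,
        Finset.card_pair hay, Finset.card_pair hxz]
    · have hx : x.val % 2 = 0 := by omega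
      have hy : y.val % 2 = 1 := by omega
      have hz : z.val % 2 = 0 := by omega
      simp [hs, Finset.filter_insert, Finset.filter_singleton, h, hx, hy, hz,
        Finset.card_pair hay, Finset.card_pair hxz]
  · intro x y hxy
    obtain ⟨p, q, r, hpqr, h0, h1, h2, hp, hq, hr⟩ := exists_alternating_corners hF hxy.1
    have hy := hxy.2.1
    simp only [hpqr, Finset.mem_insert, Finset.mem_singleton] at hy
    unfold IsBlackV
    rcases hy with rfl | rfl | rfl | rfl
    · rfl
    · have hside := (isSide_of_corners hpqr h0 h1 h2).1
      refine absurd ?_ (hxy.not_one_sided (c := r) (.inr ⟨rfl, rfl⟩) fun e he => ?_)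
      · rw [cross_swap]
        linarith [cross_vtx_pos h0 (h1.trans h2)]
      · rw [cross_swap]
        linarith [cross_vtx_nonneg (hside.2.2.2 e he)]
    · omega
    · refine absurd (cross_vtx_neg h0 (h1.trans h2))
        (hxy.not_one_sided (.inl ⟨rfl, rfl⟩) fun e he => cross_vtx_nonpos ?_)
      simp only [hpqr, Finset.mem_insert, Finset.mem_singleton] at he
      rcases he with rfl | rfl | rfl | rfl
      · simp
      all_goals omega

end
end

section
/- Let S be a connected, noncompact topological 2-manifold (Hausdorff, second countable, without boundary) and let a, b ∈ S. Then every path component of the space of continuous paths in S from a to b, equipped with the compact-open topology, is contractible. -/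
open Set Topology Filter Metric

/-- A space is locally planar if every point is the centre of an open embedding of the plane.
The plane is modelled on `ℝ × ℝ`, whose norm is the sup norm, so that spheres are squares. -/
class LocallyPlanar (X : Type*) [TopologicalSpace X] : Prop where
  exists_chart : ∀ x : X, ∃ e : ℝ × ℝ → X, IsOpenEmbedding e ∧ e 0 = x

namespace LocallyPlanar

variable {X : Type*} [TopologicalSpace X]

/-- The charted space structure given by all the plane charts. -/
noncomputable abbrev chartedSpace (X : Type*) [TopologicalSpace X] [LocallyPlanar X] :
    ChartedSpace (ℝ × ℝ) X where
  atlas := univ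
  chartAt x := ((exists_chart x).choose_spec.1.toOpenPartialHomeomorph _).symm
  mem_chart_source x := by
    simpa using ⟨0, 0, (exists_chart x).choose_spec.2⟩
  chart_mem_atlas _ := mem_univ _

instance (priority := 50) [LocallyPlanar X] : LocallyConnectedSpace X :=
  letI := chartedSpace X
  ChartedSpace.locallyConnectedSpace (ℝ × ℝ) X

instance (priority := 50) [LocallyPlanar X] : LocallyPathConnectedSpace X :=
  letI := chartedSpace X
  ChartedSpace.locallyPathConnectedSpace (ℝ × ℝ) X

instance (priority := 50) [LocallyPlanar X] : LocallyCompactSpace X :=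
  letI := chartedSpace X
  ChartedSpace.locallyCompactSpace (ℝ × ℝ) X

theorem isOpenEmbedding_smul {e : ℝ × ℝ → X} (he : IsOpenEmbedding e) {r : ℝ} (hr : r ≠ 0) :
    IsOpenEmbedding fun v => e (r • v) :=
  he.comp (Homeomorph.smulOfNeZero r hr).isOpenEmbedding

theorem exists_chart_closedBall_subset [LocallyPlanar X] {U : Set X} (hU : IsOpen U) {x : X}
    (hx : x ∈ U) :
    ∃ e : ℝ × ℝ → X, IsOpenEmbedding e ∧ e 0 = x ∧ e '' closedBall 0 1 ⊆ U := by
  obtain ⟨e, he, rfl⟩ := exists_chart x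
  obtain ⟨r, hr, hball⟩ := nhds_basis_closedBall.mem_iff.1
    ((hU.preimage he.continuous).mem_nhds hx)
  refine ⟨_, isOpenEmbedding_smul he hr.ne', by simp, ?_⟩
  rintro _ ⟨v, hv, rfl⟩
  refine hball ?_
  simp only [mem_closedBall, dist_zero_right] at hv ⊢
  rw [norm_smul, Real.norm_of_nonneg hr.le]
  nlinarith

end LocallyPlanar

section ExtendById

variable {X T : Type*}

open Classical in
/-- Transport a family of self-maps of the plane to `X` along `e`, extending it by the identity
outside the range of `e`. -/
noncomputable def extendById (e : ℝ × ℝ → X) (G : T × (ℝ × ℝ) → ℝ × ℝ) (z : T × X) : X :=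
  if z.2 ∈ range e then e (G (z.1, Function.invFun e z.2)) else z.2

theorem extendById_apply {e : ℝ × ℝ → X} (he : Function.Injective e)
    (G : T × (ℝ × ℝ) → ℝ × ℝ) (t : T) (v : ℝ × ℝ) :
    extendById e G (t, e v) = e (G (t, v)) := by
  simp [extendById, Function.leftInverse_invFun he v]

theorem extendById_of_notMem {e : ℝ × ℝ → X} (G : T × (ℝ × ℝ) → ℝ × ℝ) (t : T) {x : X}
    (hx : x ∉ range e) : extendById e G (t, x) = x :=
  if_neg hx

theorem extendById_of_notMem_image {e : ℝ × ℝ → X} (he : Function.Injective e)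
    {G : T × (ℝ × ℝ) → ℝ × ℝ} (hG : ∀ t v, v ∉ closedBall (0 : ℝ × ℝ) 1 → G (t, v) = v) (t : T)
    {x : X} (hx : x ∉ e '' closedBall 0 1) : extendById e G (t, x) = x := by
  by_cases h : x ∈ range e
  · obtain ⟨v, rfl⟩ := h
    rw [extendById_apply he, hG t v (fun hv => hx ⟨v, hv, rfl⟩)]
  · exact extendById_of_notMem G t h

theorem continuousAt_extendById [TopologicalSpace X] [T2Space X] [TopologicalSpace T]
    {e : ℝ × ℝ → X} (he : IsOpenEmbedding e)
    {G : T × (ℝ × ℝ) → ℝ × ℝ} (hG : ∀ t v, v ∉ closedBall (0 : ℝ × ℝ) 1 → G (t, v) = v)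
    {t : T} {x : X} (hc : ∀ v, x = e v → ContinuousAt G (t, v)) :
    ContinuousAt (extendById e G) (t, x) := by
  by_cases h : x ∈ range e
  · obtain ⟨v, rfl⟩ := h
    have hmap : IsOpenEmbedding (Prod.map id e : T × (ℝ × ℝ) → T × X) :=
      IsOpenEmbedding.id.prodMap he
    refine (hmap.continuousAt_iff (x := (t, v))).1 ?_
    have heq : extendById e G ∘ Prod.map id e = e ∘ G := by
      funext ⟨s, w⟩
      simp [extendById_apply he.injective]
    rw [heq]
    exact he.continuous.continuousAt.comp (hc v rfl)
  · have hopen : IsOpen (e '' closedBall 0 1)ᶜ :=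
      ((isCompact_closedBall 0 1).image he.continuous).isClosed.isOpen_compl
    have hmem : x ∈ (e '' closedBall 0 1)ᶜ := fun ⟨v, _, hv⟩ => h ⟨v, hv⟩
    have : extendById e G =ᶠ[𝓝 (t, x)] Prod.snd := by
      filter_upwards [continuous_snd.continuousAt.preimage_mem_nhds (hopen.mem_nhds hmem)]
        with z hz
      exact extendById_of_notMem_image he.injective hG z.1 hz
    exact continuous_snd.continuousAt.congr this.symm

end ExtendById

section Shift

/-- The map that translates the centre of the unit ball to `v` and is the identity outside it. -/
noncomputable def ballShift (v x : ℝ × ℝ) : ℝ × ℝ := x + max 0 (1 - ‖x‖) • v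

theorem ballShift_injective {v : ℝ × ℝ} (hv : ‖v‖ < 1) : Function.Injective (ballShift v) := by
  intro x y hxy
  have h1 : x - y = (max 0 (1 - ‖y‖) - max 0 (1 - ‖x‖)) • v := by
    rw [sub_smul]
    unfold ballShift at hxy
    linear_combination (exp := 1) hxy
  have h2 : |max 0 (1 - ‖y‖) - max 0 (1 - ‖x‖)| ≤ ‖x - y‖ := by
    refine (abs_max_sub_max_le_max 0 (1 - ‖y‖) 0 (1 - ‖x‖)).trans ?_
    simpa using abs_norm_sub_norm_le x y
  have h3 : ‖x - y‖ ≤ ‖x - y‖ * ‖v‖ := by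
    conv_lhs => rw [h1, norm_smul, Real.norm_eq_abs]
    gcongr
  have h4 : ‖x - y‖ = 0 := by nlinarith [norm_nonneg (x - y)]
  exact sub_eq_zero.1 (norm_eq_zero.1 h4)

theorem ballShift_of_notMem {x : ℝ × ℝ} (v : ℝ × ℝ) (hx : x ∉ closedBall (0 : ℝ × ℝ) 1) :
    ballShift v x = x := by
  have : 1 < ‖x‖ := by simpa using hx
  simp [ballShift, max_eq_left (by linarith : 1 - ‖x‖ ≤ 0)]

variable {X : Type*} [TopologicalSpace X]

/-- `IsShift U ψ`: the map `ψ` is injective, homotopic to the identity and fixes `Uᶜ` pointwise. -/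
structure IsShift (U : Set X) (ψ : C(X, X)) : Prop where
  homotopic : ContinuousMap.Homotopic (ContinuousMap.id X) ψ
  injective : Function.Injective ψ
  eq_self : ∀ x ∉ U, ψ x = x

theorem IsShift.id (U : Set X) : IsShift U (ContinuousMap.id X) :=
  ⟨.refl _, Function.injective_id, fun _ _ => rfl⟩

theorem IsShift.comp {U : Set X} {ψ φ : C(X, X)} (hψ : IsShift U ψ) (hφ : IsShift U φ) :
    IsShift U (ψ.comp φ) where
  homotopic := by simpa using hψ.homotopic.comp hφ.homotopic
  injective := hψ.injective.comp hφ.injective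
  eq_self x hx := by simp [hφ.eq_self x hx, hψ.eq_self x hx]

theorem IsShift.mem {U : Set X} {ψ : C(X, X)} (hψ : IsShift U ψ) {x : X} (hx : x ∈ U) :
    ψ x ∈ U := by
  by_contra h
  exact h ((hψ.injective (hψ.eq_self _ h)).symm ▸ hx)

theorem exists_isShift_of_chart [T2Space X] {e : ℝ × ℝ → X} (he : IsOpenEmbedding e) {U : Set X}
    (hU : e '' closedBall 0 1 ⊆ U) {v : ℝ × ℝ} (hv : ‖v‖ < 1) :
    ∃ ψ : C(X, X), IsShift U ψ ∧ ∀ x, ψ (e x) = e (ballShift v x) := by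
  let G : unitInterval × (ℝ × ℝ) → ℝ × ℝ := fun z => ballShift ((z.1 : ℝ) • v) z.2
  have hGid : ∀ t x, x ∉ closedBall (0 : ℝ × ℝ) 1 → G (t, x) = x :=
    fun t x hx => ballShift_of_notMem _ hx
  have hGc : Continuous G := by
    unfold G ballShift
    fun_prop
  have hc : Continuous (extendById e G) :=
    continuous_iff_continuousAt.2 fun z =>
      continuousAt_extendById he hGid fun v _ => hGc.continuousAt
  refine ⟨⟨fun x => extendById e G (1, x), by fun_prop⟩, ⟨⟨⟨⟨extendById e G, hc⟩, ?_, ?_⟩⟩, ?_, ?_⟩,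
    ?_⟩
  · intro x
    by_cases hx : x ∈ range e
    · obtain ⟨w, rfl⟩ := hx
      simp [extendById_apply he.injective, G, ballShift]
    · simp [extendById_of_notMem G 0 hx]
  · intro x
    rfl
  · intro x y hxy
    simp only [ContinuousMap.coe_mk] at hxy
    by_cases hx : x ∈ range e <;> by_cases hy : y ∈ range e
    · obtain ⟨x, rfl⟩ := hx
      obtain ⟨y, rfl⟩ := hy
      rw [extendById_apply he.injective, extendById_apply he.injective] at hxy
      have := he.injective hxy
      simp only [G, Icc.coe_one, one_smul] at this
      rw [ballShift_injective hv this]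
    · obtain ⟨x, rfl⟩ := hx
      rw [extendById_apply he.injective, extendById_of_notMem G 1 hy] at hxy
      exact absurd ⟨_, hxy⟩ hy
    · obtain ⟨y, rfl⟩ := hy
      rw [extendById_apply he.injective, extendById_of_notMem G 1 hx] at hxy
      exact absurd ⟨_, hxy.symm⟩ hx
    · rwa [extendById_of_notMem G 1 hx, extendById_of_notMem G 1 hy] at hxy
  · exact fun x hx => extendById_of_notMem_image he.injective hGid 1 fun h => hx (hU h)
  · intro x
    simp [extendById_apply he.injective, G]

theorem eventually_exists_isShift [T2Space X] [LocallyPlanar X] {U : Set X} (hU : IsOpen U) {x : X}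
    (hx : x ∈ U) :
    ∀ᶠ y in 𝓝 x, (∃ ψ : C(X, X), IsShift U ψ ∧ ψ x = y) ∧ ∃ ψ : C(X, X), IsShift U ψ ∧ ψ y = x := by
  obtain ⟨e, he, rfl, heU⟩ := LocallyPlanar.exists_chart_closedBall_subset hU hx
  have hmem : e '' ball 0 (1 / 2) ∈ 𝓝 (e 0) :=
    (he.isOpenMap _ isOpen_ball).mem_nhds ⟨0, by simp, rfl⟩
  filter_upwards [hmem]
  rintro _ ⟨v, hv, rfl⟩
  have hv' : ‖v‖ < 1 / 2 := by simpa using hv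
  constructor
  · obtain ⟨ψ, hψ, h⟩ := exists_isShift_of_chart he heU (v := v) (by linarith)
    exact ⟨ψ, hψ, by simp [h, ballShift]⟩
  · have h1 : 0 < 1 - ‖v‖ := by linarith
    obtain ⟨ψ, hψ, h⟩ := exists_isShift_of_chart he heU (v := -((1 - ‖v‖)⁻¹ • v)) (by
      rw [norm_neg, norm_smul, norm_inv, Real.norm_of_nonneg h1.le, inv_mul_lt_iff₀ h1]
      linarith)
    refine ⟨ψ, hψ, ?_⟩
    rw [h, ballShift, max_eq_right h1.le, smul_neg, smul_smul, mul_inv_cancel₀ h1.ne', one_smul,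
      add_neg_cancel]

theorem exists_isShift_notMem_image [T2Space X] [LocallyPlanar X] [ConnectedSpace X]
    (hX : ¬ CompactSpace X)
    {U K : Set X} (hU : IsOpen U) (hK : IsCompact K) (hKU : K ⊆ U) {p : X} (hp : p ∈ U) :
    ∃ ψ : C(X, X), IsShift U ψ ∧ p ∉ ψ '' K := by
  have hV : IsOpen (connectedComponentIn U p) := hU.connectedComponentIn
  have hpV : p ∈ connectedComponentIn U p := mem_connectedComponentIn hp
  obtain ⟨q, hqV, hqK⟩ : ∃ q ∈ connectedComponentIn U p, q ∉ K := by
    by_contra! h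
    have hclosure : closure (connectedComponentIn U p) ⊆ K := closure_minimal h hK.isClosed
    have hclosed : IsClosed (connectedComponentIn U p) :=
      closure_subset_iff_isClosed.1 <| isPreconnected_connectedComponentIn.closure
        |>.subset_connectedComponentIn (subset_closure hpV) (hclosure.trans hKU)
    have huniv : connectedComponentIn U p = univ := IsClopen.eq_univ ⟨hclosed, hV⟩ ⟨p, hpV⟩
    exact hX ⟨by rwa [← univ_subset_iff.1 (huniv ▸ h : univ ⊆ K)]⟩
  obtain ⟨ψ, hψ, hqp⟩ := isPreconnected_connectedComponentIn.induction₂'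
    (fun x y => ∃ ψ : C(X, X), IsShift U ψ ∧ ψ x = y)
    (fun x hx => mem_nhdsWithin_of_mem_nhds
      (eventually_exists_isShift hU (connectedComponentIn_subset _ _ hx)))
    (by
      rintro x _ _ _ _ _ ⟨ψ, hψ, rfl⟩ ⟨φ, hφ, rfl⟩
      exact ⟨φ.comp ψ, hφ.comp hψ, rfl⟩) hqV hpV
  refine ⟨ψ, hψ, ?_⟩
  rintro ⟨x, hx, hxp⟩
  exact hqK (hψ.injective (hxp.trans hqp.symm) ▸ hx)

theorem exists_homotopic_id_image_subset_diff [T2Space X] [LocallyPlanar X] [ConnectedSpace X]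
    (hX : ¬ CompactSpace X) {W K : Set X} (hW : IsOpen W) (hK : IsCompact K) (hKW : K ⊆ W)
    {F : Set X} (hF : F.Finite) :
    ∃ ψ : C(X, X), ContinuousMap.Homotopic (ContinuousMap.id X) ψ ∧ ψ '' K ⊆ W \ F := by
  induction F, hF using Set.Finite.induction_on with
  | empty => exact ⟨ContinuousMap.id X, .refl _, by simpa using hKW⟩
  | @insert p F _ hF ih =>
    obtain ⟨ψ, hψ, hψK⟩ := ih
    by_cases hp : p ∈ W \ F
    · obtain ⟨φ, hφ, hφp⟩ := exists_isShift_notMem_image hX (hW.sdiff hF.isClosed)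
        (hK.image ψ.continuous) hψK hp
      refine ⟨φ.comp ψ, by simpa using hφ.homotopic.comp hψ, ?_⟩
      rintro _ ⟨x, hx, rfl⟩
      have h := hφ.mem (hψK ⟨x, hx, rfl⟩)
      refine ⟨h.1, ?_⟩
      rintro (h' | h')
      · exact hφp ⟨ψ x, ⟨x, hx, rfl⟩, h'⟩
      · exact h.2 h'
    · refine ⟨ψ, hψ, fun y hy => ⟨(hψK hy).1, ?_⟩⟩
      rintro (rfl | h')
      · exact hp (hψK hy)
      · exact (hψK hy).2 h'

end Shift

section RadialPush

variable {X Y : Type*} [TopologicalSpace X] [T2Space X] [TopologicalSpace Y]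

/-- The radial homotopy from the identity of the punctured plane to the map that pushes the
punctured unit ball to the unit sphere. -/
noncomputable def radialPush (z : unitInterval × (ℝ × ℝ)) : ℝ × ℝ :=
  (1 + (z.1 : ℝ) * (max 1 ‖z.2‖⁻¹ - 1)) • z.2

theorem exists_homotopic_radialPush {e : ℝ × ℝ → X} (he : IsOpenEmbedding e) (f : C(Y, X))
    (hf : ∀ y, f y ≠ e 0) :
    ∃ g : C(Y, X), ContinuousMap.Homotopic f g ∧
      (∀ y, f y ∈ e '' ball 0 1 → g y ∈ e '' sphere 0 1) ∧
      ∀ y, g y = f y ∨ g y ∈ e '' sphere 0 1 := by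
  have hid : ∀ t v, v ∉ closedBall (0 : ℝ × ℝ) 1 → radialPush (t, v) = v := by
    intro t v hv
    have : 1 < ‖v‖ := by simpa using hv
    simp [radialPush, max_eq_left (inv_le_one_of_one_le₀ this.le)]
  have hcont : ∀ t y, ContinuousAt (extendById e radialPush) (t, f y) := by
    refine fun t y => continuousAt_extendById he hid fun v hv => ?_
    have hv0 : v ≠ 0 := fun h => hf y (by rw [hv, h])
    have : ‖v‖ ≠ 0 := by simpa using hv0
    unfold radialPush
    have h2 : ContinuousAt (fun z : unitInterval × (ℝ × ℝ) => ‖z.2‖⁻¹) (t, v) :=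
      ContinuousAt.inv₀ (by fun_prop) this
    fun_prop
  have hc : Continuous fun z : unitInterval × Y => extendById e radialPush (z.1, f z.2) :=
    continuous_iff_continuousAt.2 fun z => ContinuousAt.comp (f := fun z : unitInterval × Y =>
      (z.1, f z.2)) (hcont z.1 z.2) (by fun_prop)
  have hball : ∀ v : ℝ × ℝ, v ≠ 0 → ‖v‖ ≤ 1 → radialPush (1, v) ∈ sphere (0 : ℝ × ℝ) 1 := by
    intro v hv0 hv
    have : 0 < ‖v‖ := norm_pos_iff.2 hv0
    simp [radialPush, max_eq_right ((one_le_inv₀ this).2 hv), norm_smul, this.ne']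
  refine ⟨⟨fun y => extendById e radialPush (1, f y),
      hc.comp (Continuous.prodMk_right (1 : unitInterval))⟩,
    ⟨⟨⟨fun z => extendById e radialPush (z.1, f z.2), hc⟩, ?_, fun y => rfl⟩⟩, ?_, ?_⟩
  · intro y
    by_cases hx : f y ∈ range e
    · obtain ⟨w, hw⟩ := hx
      simp [← hw, extendById_apply he.injective, radialPush]
    · simp [extendById_of_notMem radialPush 0 hx]
  · rintro y ⟨v, hv, hvy⟩
    have hv0 : v ≠ 0 := fun h => hf y (by rw [← hvy, h])
    refine ⟨_, hball v hv0 (by simpa using (mem_ball.1 hv).le), ?_⟩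
    simp [← hvy, extendById_apply he.injective]
  · intro y
    by_cases hy : f y ∈ e '' closedBall 0 1
    · obtain ⟨v, hv, hvy⟩ := hy
      have hv0 : v ≠ 0 := fun h => hf y (by rw [← hvy, h])
      refine Or.inr ⟨_, hball v hv0 (by simpa using hv), ?_⟩
      simp [← hvy, extendById_apply he.injective]
    · exact Or.inl (extendById_of_notMem_image he.injective hid 1 hy)

theorem exists_homotopic_mem_iUnion_sphere {ι : Type*} [Fintype ι] {e : ι → ℝ × ℝ → X}
    (he : ∀ i, IsOpenEmbedding (e i)) (hsphere : ∀ i j, e i 0 ∉ e j '' sphere 0 1) (f : C(Y, X))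
    (hf : ∀ y, ∃ i, f y ∈ e i '' ball 0 1) (hf0 : ∀ y i, f y ≠ e i 0) :
    ∃ g : C(Y, X), ContinuousMap.Homotopic f g ∧ ∀ y, ∃ i, g y ∈ e i '' sphere 0 1 := by
  classical
  suffices h : ∀ s : Finset ι, ∃ g : C(Y, X), ContinuousMap.Homotopic f g ∧ (∀ y i, g y ≠ e i 0) ∧
      ∀ y, (∃ i ∈ s, g y ∈ e i '' sphere 0 1) ∨ ∃ i ∉ s, g y ∈ e i '' ball 0 1 by
    obtain ⟨g, hfg, -, hg⟩ := h Finset.univ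
    exact ⟨g, hfg, fun y => by simpa using hg y⟩
  intro s
  induction s using Finset.induction_on with
  | empty => exact ⟨f, .refl _, hf0, by simpa using hf⟩
  | insert j s hj ih =>
    obtain ⟨g, hfg, hg0, hg⟩ := ih
    obtain ⟨k, hgk, hball, heq⟩ := exists_homotopic_radialPush (he j) g (fun y => hg0 y j)
    refine ⟨k, hfg.trans hgk, fun y i hi => ?_, fun y => ?_⟩
    · rcases heq y with h | h
      · exact hg0 y i (h ▸ hi)
      · exact hsphere i j (hi ▸ h)
    · rcases heq y with h | h
      · rcases hg y with ⟨i, hi, hgi⟩ | ⟨i, hi, hgi⟩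
        · exact .inl ⟨i, Finset.mem_insert_of_mem hi, h ▸ hgi⟩
        · by_cases hij : i = j
          · subst hij
            exact .inl ⟨i, Finset.mem_insert_self _ _, hball y hgi⟩
          · exact .inr ⟨i, by simp [hij, hi], h ▸ hgi⟩
      · exact .inl ⟨j, Finset.mem_insert_self _ _, h⟩

end RadialPush

section NeighborhoodExtension

variable {X Y : Type*} [TopologicalSpace X] [TopologicalSpace Y]

theorem exists_extension_of_chart [NormalSpace Y] {A B : Set Y} (hA : IsClosed A)
    (hB : IsClosed B) (hBA : B ⊆ A) {f : Y → X} (hf : ContinuousOn f A) {e : ℝ × ℝ → X}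
    (he : IsOpenEmbedding e) (hfB : MapsTo f B (range e)) :
    ∃ N : Set Y, IsClosed N ∧ B ⊆ interior N ∧
      ∃ g : Y → X, ContinuousOn g (A ∪ N) ∧ EqOn g f A := by
  classical
  obtain ⟨O, hO, hfO⟩ := continuousOn_iff'.1 hf _ he.isOpen_range
  have hBO : B ⊆ O := fun y hy => (hfO.subset ⟨hfB hy, hBA hy⟩).1
  obtain ⟨O', hO', hBO', hclosure⟩ := normal_exists_closure_subset hB hO hBO
  have hD : MapsTo f (A ∩ closure O') (range e) :=
    fun y hy => (hfO.superset ⟨hclosure hy.2, hy.1⟩).1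
  have hc : ContinuousOn (Function.invFun e ∘ f) (A ∩ closure O') := by
    rw [he.isInducing.continuousOn_iff]
    refine (hf.mono inter_subset_left).congr fun y hy => ?_
    exact Function.invFun_eq (hD hy)
  obtain ⟨ĝ, hĝ⟩ := ContinuousMap.exists_restrict_eq (hA.inter isClosed_closure)
    ⟨_, continuousOn_iff_continuous_domRestrict.1 hc⟩
  have hĝ' : ∀ y ∈ A ∩ closure O', e (ĝ y) = f y := by
    intro y hy
    have := DFunLike.congr_fun hĝ ⟨y, hy⟩
    simp only [ContinuousMap.restrict_apply, ContinuousMap.coe_mk, domRestrict_apply,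
      Function.comp_apply] at this
    rw [this]
    exact Function.invFun_eq (hD hy)
  refine ⟨closure O', isClosed_closure, hBO'.trans (hO'.subset_interior_iff.2 subset_closure),
    fun y => if y ∈ A then f y else e (ĝ y), ?_, fun y hy => if_pos hy⟩
  refine ContinuousOn.union_of_isClosed (hf.congr fun y hy => if_pos hy) ?_ hA isClosed_closure
  refine (he.continuous.comp ĝ.continuous).continuousOn.congr fun y hy => ?_
  by_cases h : y ∈ A
  · simp [h, hĝ' y ⟨h, hy⟩]
  · simp [h]

/-- Locally planar spaces are absolute neighbourhood extensors for compact subsets of normal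
Hausdorff spaces. -/
theorem exists_extension_nhds [T4Space Y] [LocallyPlanar X] {A : Set Y} (hA : IsCompact A)
    {f : Y → X} (hf : ContinuousOn f A) :
    ∃ N : Set Y, IsOpen N ∧ A ⊆ N ∧ ∃ g : Y → X, ContinuousOn g N ∧ EqOn g f A := by
  classical
  have hlocal : ∀ a ∈ A, ∃ B : Set Y, IsClosed B ∧ B ∈ 𝓝 a ∧
      ∃ e : ℝ × ℝ → X, IsOpenEmbedding e ∧ MapsTo f (A ∩ B) (range e) := by
    intro a ha
    obtain ⟨e, he, hea⟩ := LocallyPlanar.exists_chart (f a)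
    obtain ⟨O, hO, hfO⟩ := continuousOn_iff'.1 hf _ he.isOpen_range
    have haO : a ∈ O := (hfO.subset ⟨⟨0, hea⟩, ha⟩).1
    obtain ⟨B, hBa, hB, hBO⟩ := exists_mem_nhds_isClosed_subset (hO.mem_nhds haO)
    exact ⟨B, hB, hBa, e, he, fun y hy => (hfO.superset ⟨hBO hy.2, hy.1⟩).1⟩
  choose! B hB hBa e he hfe using hlocal
  obtain ⟨s, hsA, hs⟩ := hA.elim_nhds_subcover B hBa
  have key : ∀ t : Finset Y, (∀ a ∈ t, a ∈ A) → ∃ N : Set Y, IsClosed N ∧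
      (∀ a ∈ t, A ∩ B a ⊆ interior N) ∧ ∃ g : Y → X, ContinuousOn g (A ∪ N) ∧ EqOn g f A := by
    intro t
    induction t using Finset.induction_on with
    | empty => exact fun _ => ⟨∅, isClosed_empty, by simp, f, by simpa using hf, fun _ _ => rfl⟩
    | insert a t _ ih =>
      intro ht
      obtain ⟨N, hN, hBN, g, hg, hgf⟩ := ih fun b hb => ht b (Finset.mem_insert_of_mem hb)
      have ha := ht a (Finset.mem_insert_self _ _)
      obtain ⟨M, hM, hBM, k, hk, hkg⟩ := exists_extension_of_chart (hA.isClosed.union hN)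
        (hA.isClosed.inter (hB a ha)) (inter_subset_left.trans subset_union_left) hg (he a ha)
        (fun y hy => hgf hy.1 ▸ hfe a ha hy)
      refine ⟨N ∪ M, hN.union hM, ?_, k, by rwa [← union_assoc],
        fun y hy => (hkg (.inl hy)).trans (hgf hy)⟩
      intro b hb
      rcases Finset.mem_insert.1 hb with rfl | hb
      · exact hBM.trans (interior_mono subset_union_right)
      · exact (hBN b hb).trans (interior_mono subset_union_left)
  obtain ⟨N, -, hBN, g, hg, hgf⟩ := key s hsA
  refine ⟨interior N, isOpen_interior, fun y hy => ?_, g,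
    hg.mono (interior_subset.trans subset_union_right), hgf⟩
  obtain ⟨a, ha, hya⟩ := mem_iUnion₂.1 (hs hy)
  exact hBN a ha ⟨hy, hya⟩

/-- `NullHomotopicOn K`: the inclusion of `K` in the ambient space is homotopic to a constant. -/
def NullHomotopicOn (K : Set X) : Prop :=
  ∃ c : X, ∃ H : X × ℝ → X, ContinuousOn H (K ×ˢ Icc 0 1) ∧ (∀ x ∈ K, H (x, 0) = x) ∧
    ∀ x ∈ K, H (x, 1) = c

theorem exists_extension_of_nullHomotopicOn [T4Space (Y × ℝ)] [T4Space Y] [LocallyPlanar X]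
    {A Z : Set Y} (hA : IsCompact A) (hZ : IsCompact Z) {f : Y → X} (hf : ContinuousOn f A)
    (hnull : NullHomotopicOn (f '' A)) :
    ∃ g : Y → X, ContinuousOn g Z ∧ EqOn g f A := by
  classical
  obtain ⟨c, H, hH, hH0, hH1⟩ := hnull
  have hAI : IsCompact (A ×ˢ Icc (0 : ℝ) 1) := hA.prod isCompact_Icc
  have hZ1 : IsCompact (Z ×ˢ ({1} : Set ℝ)) := hZ.prod isCompact_singleton
  have hf' : ContinuousOn (fun z : Y × ℝ => if z.1 ∈ A then H (f z.1, z.2) else c)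
      (A ×ˢ Icc (0 : ℝ) 1 ∪ Z ×ˢ {1}) := by
    refine ContinuousOn.union_of_isClosed ?_ ?_ hAI.isClosed hZ1.isClosed
    · refine ContinuousOn.congr (f := fun z : Y × ℝ => H (f z.1, z.2)) ?_
        fun z hz => if_pos hz.1
      refine hH.comp ((hf.comp continuousOn_fst fun z hz => hz.1).prodMk continuousOn_snd) ?_
      exact fun z hz => ⟨⟨z.1, hz.1, rfl⟩, hz.2⟩
    · refine continuousOn_const (c := c) |>.congr fun z hz => ?_
      split_ifs with h
      · rw [show z.2 = 1 from hz.2, hH1 _ ⟨z.1, h, rfl⟩]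
      · rfl
  obtain ⟨N, hN, hAN, g, hg, hgf⟩ := exists_extension_nhds (hAI.union hZ1) hf'
  obtain ⟨O, V, hO, -, hAO, hV, hOV⟩ := generalized_tube_lemma hA (isCompact_Icc (a := (0 : ℝ))
    (b := 1)) hN (subset_union_left.trans hAN)
  obtain ⟨u, hu0, hu1, hu⟩ := exists_continuous_zero_one_of_isClosed hA.isClosed hO.isClosed_compl
    (disjoint_compl_right_iff_subset.2 hAO)
  refine ⟨fun y => g (y, u y), hg.comp (by fun_prop) fun y hy => ?_, fun y hy => ?_⟩
  · by_cases hyO : y ∈ O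
    · exact hOV ⟨hyO, hV (hu y)⟩
    · exact hAN (.inr ⟨hy, hu1 hyO⟩)
  · have h0 : u y = 0 := hu0 hy
    have := hgf (x := (y, 0)) (.inl ⟨hy, by simp⟩)
    simp only [hy, if_true] at this
    change g (y, u y) = f y
    rw [h0, this, hH0 _ ⟨y, hy, rfl⟩]

/-- A locally planar space all of whose compact subsets contract in it is contractible. -/
theorem contractibleSpace_of_nullHomotopicOn [T2Space X] [LocallyPlanar X] [SigmaCompactSpace X]
    [Nonempty X] (h : ∀ K : Set X, IsCompact K → NullHomotopicOn K) :
    ∃ c : X, ∃ H : C(X × unitInterval, X), (∀ x, H (x, 0) = x) ∧ ∀ x, H (x, 1) = c := by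
  classical
  let c : X := Classical.arbitrary X
  let E : CompactExhaustion X := (default : CompactExhaustion X).shiftr
  let P (n : ℕ) (H : X × ℝ → X) : Prop := ContinuousOn H (E n ×ˢ Icc 0 1) ∧
    (∀ x ∈ E n, H (x, 0) = x) ∧ ∀ x ∈ E n, H (x, 1) = c
  have step : ∀ n H, P n H → ∃ H', P (n + 1) H' ∧ EqOn H' H (E n ×ˢ Icc 0 1) := by
    rintro n H ⟨hc, h0, h1⟩
    have hn : IsCompact (E n ×ˢ Icc (0 : ℝ) 1) := (E.isCompact n).prod isCompact_Icc
    have hs (t : ℝ) : IsCompact (E (n + 1) ×ˢ ({t} : Set ℝ)) :=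
      (E.isCompact (n + 1)).prod isCompact_singleton
    let f : X × ℝ → X := fun z => if z.1 ∈ E n then H z else if z.2 = 0 then z.1 else c
    have hf0 : ∀ x, f (x, 0) = x := by
      intro x
      by_cases hx : x ∈ E n
      · simp [f, hx, h0 x hx]
      · simp [f, hx]
    have hf1 : ∀ x, f (x, 1) = c := by
      intro x
      by_cases hx : x ∈ E n
      · simp [f, hx, h1 x hx]
      · simp [f, hx]
    have hf : ContinuousOn f (E n ×ˢ Icc (0 : ℝ) 1 ∪ (E (n + 1) ×ˢ {0} ∪ E (n + 1) ×ˢ {1})) := by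
      refine ContinuousOn.union_of_isClosed (hc.congr fun z hz => if_pos hz.1) ?_ hn.isClosed
        ((hs 0).union (hs 1)).isClosed
      refine ContinuousOn.union_of_isClosed ?_ ?_ (hs 0).isClosed (hs 1).isClosed
      · refine continuousOn_fst.congr ?_
        rintro ⟨x, t⟩ ⟨-, ht⟩
        obtain rfl : t = 0 := ht
        exact hf0 x
      · refine (continuousOn_const (c := c)).congr ?_
        rintro ⟨x, t⟩ ⟨-, ht⟩
        obtain rfl : t = 1 := ht
        exact hf1 x
    have hA := hn.union ((hs 0).union (hs 1))
    obtain ⟨H', hH', hHf⟩ := exists_extension_of_nullHomotopicOn hA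
      ((E.isCompact (n + 1)).prod (isCompact_Icc (a := (0 : ℝ)) (b := 1))) hf
      (h _ (hA.image_of_continuousOn hf))
    refine ⟨H', ⟨hH', fun x hx => ?_, fun x hx => ?_⟩, fun z hz => ?_⟩
    · rw [hHf (x := (x, 0)) (.inr (.inl ⟨hx, rfl⟩)), hf0]
    · rw [hHf (x := (x, 1)) (.inr (.inr ⟨hx, rfl⟩)), hf1]
    · rw [hHf (.inl hz)]
      exact if_pos hz.1
  choose! next hnext hnext_eq using step
  let F : ℕ → X × ℝ → X := fun n => Nat.rec Prod.fst next n
  have hF : ∀ n, P n (F n) := by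
    intro n
    induction n with
    | zero =>
      have hE (x : X) : x ∉ E 0 := id
      refine ⟨?_, fun x hx => (hE x hx).elim, fun x hx => (hE x hx).elim⟩
      exact fun z hz => (hE z.1 hz.1).elim
    | succ n ih => exact hnext n _ ih
  have hFF : ∀ m n, m ≤ n → EqOn (F n) (F m) (E m ×ˢ Icc 0 1) := by
    intro m n hmn
    induction n, hmn using Nat.le_induction with
    | base => exact fun _ _ => rfl
    | succ n hmn ih =>
      intro z hz
      rw [← ih hz]
      exact hnext_eq n _ (hF n) ⟨E.subset hmn hz.1, hz.2⟩
  let H : X × unitInterval → X := fun z => F (E.find z.1) (z.1, z.2)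
  have hHF : ∀ n x (t : unitInterval), x ∈ E n → H (x, t) = F n (x, t) := fun n x t hx =>
    (hFF _ _ (E.mem_iff_find_le.1 hx) ⟨E.mem_find x, t.2⟩).symm
  refine ⟨c, ⟨H, continuous_iff_continuousAt.2 ?_⟩, fun x => ?_, fun x => ?_⟩
  · rintro ⟨x, t⟩
    obtain ⟨n, hn⟩ := E.exists_mem_nhds x
    have hev : ∀ᶠ z : X × unitInterval in 𝓝 (x, t), z.1 ∈ E n :=
      continuous_fst.continuousAt.preimage_mem_nhds hn
    have hHeq : H =ᶠ[𝓝 (x, t)] fun z => F n (z.1, z.2) := by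
      filter_upwards [hev] with z hz using hHF n z.1 z.2 hz
    refine ContinuousAt.congr ?_ hHeq.symm
    have hcw : ContinuousWithinAt (F n) (E n ×ˢ Icc 0 1) (x, (t : ℝ)) :=
      (hF n).1 _ ⟨mem_of_mem_nhds hn, t.2⟩
    refine hcw.tendsto.comp (tendsto_nhdsWithin_iff.2 ⟨?_, ?_⟩)
    · exact Continuous.tendsto (f := fun z : X × unitInterval => (z.1, (z.2 : ℝ))) (by fun_prop)
        (x, t)
    · filter_upwards [hev] with z hz using ⟨hz, z.2.2⟩
  · exact (hF _).2.1 x (E.mem_find x)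
  · exact (hF _).2.2 x (E.mem_find x)

end NeighborhoodExtension

section SquareFilling

open unitInterval

variable {X : Type*} [TopologicalSpace X]

/-- A homotopy rel endpoints may be composed with a time function which is discontinuous where
the position is an endpoint. -/
theorem continuous_pathHomotopy_comp {Z : Type*} [TopologicalSpace Z] {x₀ x₁ : X}
    {γ₀ γ₁ : Path x₀ x₁} (K : γ₀.Homotopy γ₁) {τ u : Z → I} (hu : Continuous u)
    (hτ : ∀ z, u z ≠ 0 → u z ≠ 1 → ContinuousAt τ z) :
    Continuous fun z => K (τ z, u z) := by
  refine continuous_iff_continuousAt.2 fun z => ?_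
  by_cases hz : u z = 0 ∨ u z = 1
  · have hconst : ∀ s, K (s, u z) = K (τ z, u z) := by
      intro s
      rcases hz with hz | hz <;> simp [hz]
    intro V hV
    obtain ⟨V', hV'V, hV', hzV⟩ := mem_nhds_iff.1 hV
    obtain ⟨O, W, -, hW, hO, hzW, hOW⟩ := generalized_tube_lemma (isCompact_univ (X := I))
      (isCompact_singleton (x := u z)) (hV'.preimage K.continuous)
      (by rintro ⟨s, w⟩ ⟨-, rfl⟩
          exact mem_preimage.2 ((hconst s).symm ▸ (hzV : K (τ z, u z) ∈ V')))
    refine mem_map.2 ?_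
    filter_upwards [hu.continuousAt.preimage_mem_nhds (hW.mem_nhds (hzW rfl))] with y hy
    exact hV'V (hOW ⟨hO (mem_univ _), hy⟩)
  · push Not at hz
    exact K.continuous.continuousAt.comp ((hτ z hz.1 hz.2).prodMk hu.continuousAt)

/-- In a simply connected space, maps from the boundary of the unit square extend. -/
theorem exists_extension_unitSquare [SimplyConnectedSpace X] {h : ℝ × ℝ → X}
    (hh : ContinuousOn h (Icc 0 1 ×ˢ {0, 1} ∪ {0, 1} ×ˢ Icc 0 1)) :
    ∃ F : ℝ × ℝ → X, Continuous F ∧ EqOn F h (Icc 0 1 ×ˢ {0, 1} ∪ {0, 1} ×ˢ Icc 0 1) := by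
  let γ₀ : Path (h (0, 0)) (h (1, 1)) :=
    { toFun := fun w => h (min (2 * w) 1, max (2 * w - 1) 0)
      continuous_toFun := by
        refine hh.comp_continuous (by fun_prop) fun w => ?_
        have h0 := w.2.1
        have h1 := w.2.2
        rcases le_total (2 * (w : ℝ)) 1 with hw | hw
        · left; simp [hw, h0]
        · right; simp [hw]; linarith
      source' := by simp
      target' := by norm_num }
  let γ₁ : Path (h (0, 0)) (h (1, 1)) :=
    { toFun := fun w => h (max (2 * w - 1) 0, min (2 * w) 1)
      continuous_toFun := by
        refine hh.comp_continuous (by fun_prop) fun w => ?_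
        have h0 := w.2.1
        have h1 := w.2.2
        rcases le_total (2 * (w : ℝ)) 1 with hw | hw
        · right; simp [hw, h0]
        · left; simp [hw]; linarith
      source' := by simp
      target' := by norm_num }
  obtain ⟨K⟩ := SimplyConnectedSpace.paths_homotopic γ₀ γ₁
  let pr : ℝ → I := projIcc 0 1 zero_le_one
  have hpr : Continuous pr := continuous_projIcc
  have hpr_of {x : ℝ} (hx : x ∈ Icc (0 : ℝ) 1) : (pr x : ℝ) = x := by
    simp [pr, projIcc_of_mem zero_le_one hx]
  let d : ℝ × ℝ → ℝ := fun z => min (pr z.2) (1 - pr z.1)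
  let d' : ℝ × ℝ → ℝ := fun z => min (pr z.1) (1 - pr z.2)
  let τ : ℝ × ℝ → I := fun z => pr (d z / (d z + d' z))
  let u : ℝ × ℝ → I := fun z => pr ((pr z.1 + pr z.2) / 2)
  have hu_coe (z : ℝ × ℝ) : (u z : ℝ) = (pr z.1 + pr z.2) / 2 := by
    refine hpr_of ⟨?_, ?_⟩ <;> linarith [(pr z.1).2.1, (pr z.2).2.1, (pr z.1).2.2, (pr z.2).2.2]
  have hu : Continuous u := by fun_prop
  refine ⟨fun z => K (τ z, u z), continuous_pathHomotopy_comp K hu fun z hz0 hz1 => ?_, ?_⟩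
  · have hne : d z + d' z ≠ 0 := by
      intro hdd
      have h1 := (pr z.1).2
      have h2 := (pr z.2).2
      have hz0' : (u z : ℝ) ≠ 0 := fun h' => hz0 (Subtype.ext h')
      have hz1' : (u z : ℝ) ≠ 1 := fun h' => hz1 (Subtype.ext h')
      rw [hu_coe] at hz0' hz1'
      simp only [d, d'] at hdd
      grind
    have hd : Continuous d := by fun_prop
    have hd' : Continuous d' := by fun_prop
    exact hpr.continuousAt.comp (hd.continuousAt.div (hd.add hd').continuousAt hne)
  · have hK0 (z : ℝ × ℝ) (hz : d z = 0) :
        K (τ z, u z) = h (min (2 * u z) 1, max (2 * u z - 1) 0) := by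
      have : τ z = 0 := by simp [τ, hz, pr]
      rw [this, K.apply_zero]
      rfl
    have hK1 (z : ℝ × ℝ) (hz : d z ≠ 0) (hz' : d' z = 0) :
        K (τ z, u z) = h (max (2 * u z - 1) 0, min (2 * u z) 1) := by
      have : τ z = 1 := by simp [τ, hz', pr, hz]
      rw [this, K.apply_one]
      rfl
    rintro ⟨s, t⟩ hst
    have hs : s ∈ Icc (0 : ℝ) 1 := by
      rcases hst with h | h
      · exact h.1
      · rcases h.1 with h | h <;> simp_all
    have ht : t ∈ Icc (0 : ℝ) 1 := by
      rcases hst with h | h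
      · rcases h.2 with h | h <;> simp_all
      · exact h.2
    have hst' : t = 0 ∨ t = 1 ∨ s = 0 ∨ s = 1 := by
      simp at hst; tauto
    have hus : 2 * (u (s, t) : ℝ) = s + t := by
      rw [hu_coe, hpr_of hs, hpr_of ht]; ring
    have hd : d (s, t) = min t (1 - s) := by simp [d, hpr_of hs, hpr_of ht]
    have hd' : d' (s, t) = min s (1 - t) := by simp [d', hpr_of hs, hpr_of ht]
    obtain ⟨hs0, hs1⟩ := hs
    obtain ⟨ht0, ht1⟩ := ht
    by_cases h0 : d (s, t) = 0
    · change K (τ (s, t), u (s, t)) = _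
      rw [hK0 _ h0, hus]
      rw [hd] at h0
      congr 2
      · clear * - h0 hs0 hs1 ht0 ht1
        grind
      · clear * - h0 hs0 hs1 ht0 ht1
        grind
    · rw [hd] at h0
      have h1 : min s (1 - t) = 0 := by
        clear * - h0 hs0 hs1 ht0 ht1 hst'
        grind
      change K (τ (s, t), u (s, t)) = _
      rw [hK1 _ (hd ▸ h0) (hd' ▸ h1), hus]
      congr 2
      · clear * - h1 hs0 hs1 ht0 ht1
        grind
      · clear * - h1 hs0 hs1 ht0 ht1
        grind

/-- Filling a square in a simply connected space, with the four sides given separately. -/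
theorem exists_square_filling [SimplyConnectedSpace X] {p q : ℝ} (hpq : p < q) {h : ℝ × ℝ → X}
    (hh : ContinuousOn h (Icc p q ×ˢ {0, 1})) {l r : ℝ → X} (hl : ContinuousOn l (Icc 0 1))
    (hr : ContinuousOn r (Icc 0 1)) (hl0 : l 0 = h (p, 0)) (hl1 : l 1 = h (p, 1))
    (hr0 : r 0 = h (q, 0)) (hr1 : r 1 = h (q, 1)) :
    ∃ F : ℝ × ℝ → X, Continuous F ∧ EqOn F h (Icc p q ×ˢ {0, 1}) ∧
      ∀ y ∈ Icc (0 : ℝ) 1, F (p, y) = l y ∧ F (q, y) = r y := by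
  classical
  let k : ℝ × ℝ → X := fun z => if z.1 = 0 then l z.2 else if z.1 = 1 then r z.2 else
    h (p + z.1 * (q - p), z.2)
  have hk (z : ℝ × ℝ) (hz : z ∈ Icc (0 : ℝ) 1 ×ˢ ({0, 1} : Set ℝ)) :
      k z = h (p + z.1 * (q - p), z.2) := by
    obtain ⟨s, t⟩ := z
    obtain ⟨-, rfl | rfl⟩ := hz
    all_goals
      by_cases hs0 : s = 0
      · simp [k, hs0, hl0, hl1]
      · by_cases hs1 : s = 1
        · simp [k, hs1, hr0, hr1]
        · simp [k, hs0, hs1]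
  have hmem {s : ℝ} (hs : s ∈ Icc (0 : ℝ) 1) : p + s * (q - p) ∈ Icc p q :=
    ⟨by nlinarith [hs.1], by nlinarith [hs.2]⟩
  have hc : ContinuousOn k (Icc 0 1 ×ˢ {0, 1} ∪ {0, 1} ×ˢ Icc 0 1) := by
    have hfin : IsClosed ({0, 1} : Set ℝ) := (toFinite _).isClosed
    refine ContinuousOn.union_of_isClosed ?_ ?_ (isClosed_Icc.prod hfin) (hfin.prod isClosed_Icc)
    · refine ContinuousOn.congr (hh.comp (f := fun z : ℝ × ℝ => (p + z.1 * (q - p), z.2))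
        (by fun_prop) fun z hz => ⟨hmem hz.1, hz.2⟩) hk
    · rw [insert_eq, union_prod]
      refine ContinuousOn.union_of_isClosed ?_ ?_ (isClosed_singleton.prod isClosed_Icc)
        (isClosed_singleton.prod isClosed_Icc)
      · exact (hl.comp continuousOn_snd fun z hz => hz.2).congr fun z hz => if_pos hz.1
      · refine (hr.comp continuousOn_snd fun z hz => hz.2).congr fun z hz => ?_
        simp [k, show z.1 = 1 from hz.1]
  obtain ⟨F, hF, hFk⟩ := exists_extension_unitSquare hc
  have hqp : q - p ≠ 0 := by linarith
  refine ⟨fun z => F ((z.1 - p) / (q - p), z.2), by fun_prop, fun z hz => ?_, fun y hy => ⟨?_, ?_⟩⟩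
  · have hz' : ((z.1 - p) / (q - p), z.2) ∈ Icc (0 : ℝ) 1 ×ˢ ({0, 1} : Set ℝ) := by
      refine ⟨⟨div_nonneg ?_ ?_, (div_le_one ?_).2 ?_⟩, hz.2⟩ <;> linarith [hz.1.1, hz.1.2]
    change F _ = _
    rw [hFk (.inl hz'), hk _ hz']
    congr 1
    ext
    · simp; field_simp; ring
    · rfl
  · simp [hFk (x := (0, y)) (.inr ⟨by simp, hy⟩), k]
  · simp [hFk (x := (1, y)) (.inr ⟨by simp, hy⟩), k, hqp]

/-- In a simply connected locally planar space, a homotopy prescribed over a closed subset of an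
interval extends over the interval, with prescribed ends. -/
theorem exists_extension_Icc_prod [SimplyConnectedSpace X] [LocallyPlanar X] {p q : ℝ}
    (hpq : p ≤ q) {B : Set ℝ} (hB : IsClosed B) (hBpq : B ⊆ Icc p q) {h : ℝ × ℝ → X}
    (hh : ContinuousOn h (B ×ˢ Icc 0 1 ∪ Icc p q ×ˢ {0, 1})) :
    ∃ F : ℝ × ℝ → X, ContinuousOn F (Icc p q ×ˢ Icc 0 1) ∧
      EqOn F h (B ×ˢ Icc 0 1 ∪ Icc p q ×ˢ {0, 1}) := by
  classical
  have hfin : ({0, 1} : Set ℝ).Finite := toFinite _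
  have hBc : IsCompact B := isCompact_Icc.of_isClosed_subset hB hBpq
  obtain ⟨N, hN, hAN, g, hg, hgh⟩ := exists_extension_nhds
    ((hBc.prod isCompact_Icc).union (isCompact_Icc.prod hfin.isCompact)) hh
  obtain ⟨O, V, hO, -, hBO, hV, hOV⟩ := generalized_tube_lemma hBc
    (isCompact_Icc (a := (0 : ℝ)) (b := 1)) hN (subset_union_left.trans hAN)
  have hline : ∀ s ∈ Icc p q, ∃ l : ℝ → X, ContinuousOn l (Icc 0 1) ∧ l 0 = h (s, 0) ∧
      l 1 = h (s, 1) ∧ (s ∈ O → ∀ y ∈ Icc (0 : ℝ) 1, l y = g (s, y)) := by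
    intro s hs
    by_cases hsO : s ∈ O
    · refine ⟨fun y => g (s, y), hg.comp (by fun_prop) fun y hy => hOV ⟨hsO, hV hy⟩, ?_, ?_,
        fun _ _ _ => rfl⟩
      · exact hgh (.inr ⟨hs, by simp⟩)
      · exact hgh (.inr ⟨hs, by simp⟩)
    · let γ := PathConnectedSpace.somePath (h (s, 0)) (h (s, 1))
      exact ⟨γ.extend, γ.continuous_extend.continuousOn, γ.extend_zero, γ.extend_one,
        fun h => (hsO h).elim⟩
  choose! l hlc hl0 hl1 hlg using hline
  obtain ⟨t, ht0, htmono, ⟨m, hm⟩, htc⟩ := exists_monotone_Icc_subset_open_cover_Icc hpq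
    (c := fun i : Bool => Subtype.val ⁻¹' (if i then O else Bᶜ))
    (fun i => IsOpen.preimage continuous_subtype_val (by
      cases i; exacts [by simpa using hB.isOpen_compl, by simpa using hO]))
    (fun s _ => by
      by_cases hs : (s : ℝ) ∈ B
      · exact mem_iUnion.2 ⟨true, by simpa using hBO hs⟩
      · exact mem_iUnion.2 ⟨false, by simpa using hs⟩)
  have key : ∀ n, ∃ F : ℝ × ℝ → X, ContinuousOn F (Icc p (t n) ×ˢ Icc 0 1) ∧
      (∀ z ∈ Icc p (t n : ℝ) ×ˢ Icc (0 : ℝ) 1, z ∈ B ×ˢ Icc 0 1 ∪ Icc p q ×ˢ {0, 1} →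
        F z = h z) ∧ ∀ y ∈ Icc (0 : ℝ) 1, F (t n, y) = l (t n) y := by
    intro n
    induction n with
    | zero =>
      have hp : p ∈ Icc p q := left_mem_Icc.2 hpq
      rw [ht0]
      refine ⟨fun z => l p z.2, (hlc p hp).comp continuousOn_snd fun z hz => hz.2, ?_, ?_⟩
      · rintro ⟨s, y⟩ ⟨hs, hy⟩ hz
        obtain rfl : s = p := le_antisymm hs.2 hs.1
        rcases hz with ⟨hz, -⟩ | ⟨-, rfl | rfl⟩
        · rw [← hgh (.inl ⟨hz, hy⟩)]
          exact hlg s hp (hBO hz) y hy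
        · exact hl0 s hp
        · exact hl1 s hp
      · exact fun _ _ => rfl
    | succ n ih =>
      obtain ⟨F, hF, hFh, hFl⟩ := ih
      have hle : (t n : ℝ) ≤ t (n + 1) := htmono n.le_succ
      rcases hle.eq_or_lt with heq | hlt
      · exact ⟨F, heq ▸ hF, heq ▸ hFh, heq ▸ hFl⟩
      have hpn := (t n).2.1
      have hsub : Icc (t n : ℝ) (t (n + 1)) ⊆ Icc p q := Icc_subset_Icc hpn (t (n + 1)).2.2
      obtain ⟨G, hG, hGh, hGn, hGn'⟩ : ∃ G : ℝ × ℝ → X,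
          ContinuousOn G (Icc (t n : ℝ) (t (n + 1)) ×ˢ Icc 0 1) ∧
          (∀ z ∈ Icc (t n : ℝ) (t (n + 1)) ×ˢ Icc (0 : ℝ) 1,
            z ∈ B ×ˢ Icc 0 1 ∪ Icc p q ×ˢ {0, 1} → G z = h z) ∧
          (∀ y ∈ Icc (0 : ℝ) 1, G (t n, y) = l (t n) y) ∧
          ∀ y ∈ Icc (0 : ℝ) 1, G (t (n + 1), y) = l (t (n + 1)) y := by
        obtain ⟨i, hi⟩ := htc n
        cases i with
        | true =>
          have hi : ∀ s ∈ Icc (t n : ℝ) (t (n + 1)), s ∈ O := fun s hs => by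
            simpa using @hi ⟨s, hsub hs⟩ hs
          refine ⟨g, hg.mono fun z hz => hOV ⟨hi _ hz.1, hV hz.2⟩, fun z _ hz => hgh hz,
            fun y hy => (hlg _ (t n).2 ?_ y hy).symm,
            fun y hy => (hlg _ (t (n + 1)).2 ?_ y hy).symm⟩
          exacts [hi _ (left_mem_Icc.2 hle), hi _ (right_mem_Icc.2 hle)]
        | false =>
          have hi : ∀ s ∈ Icc (t n : ℝ) (t (n + 1)), s ∉ B := fun s hs => by
            simpa using @hi ⟨s, hsub hs⟩ hs
          obtain ⟨G, hG, hGh, hGl⟩ := exists_square_filling hlt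
            (hh.mono ((prod_mono_left hsub).trans subset_union_right)) (hlc _ (t n).2)
            (hlc _ (t (n + 1)).2) (hl0 _ (t n).2) (hl1 _ (t n).2) (hl0 _ (t (n + 1)).2)
            (hl1 _ (t (n + 1)).2)
          refine ⟨G, hG.continuousOn, fun z hz hzA => hGh ⟨hz.1, ?_⟩, fun y hy => (hGl y hy).1,
            fun y hy => (hGl y hy).2⟩
          exact hzA.elim (fun h' => (hi _ hz.1 h'.1).elim) fun h' => h'.2
      let k : ℝ × ℝ → X := fun z => if z.1 ≤ t n then F z else G z
      have hkF (z : ℝ × ℝ) (hz : z.1 ≤ t n) : k z = F z := if_pos hz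
      have hkG (z : ℝ × ℝ) (hz : (t n : ℝ) ≤ z.1) (hz2 : z.2 ∈ Icc (0 : ℝ) 1) : k z = G z := by
        rcases hz.eq_or_lt with h' | h'
        · obtain ⟨s, y⟩ := z
          obtain rfl : (t n : ℝ) = s := h'
          rw [hkF _ le_rfl, hFl y hz2, hGn y hz2]
        · exact if_neg h'.not_ge
      refine ⟨k, ?_, fun z hz hzA => ?_, fun y hy => ?_⟩
      · rw [← Icc_union_Icc_eq_Icc hpn hle, union_prod]
        refine ContinuousOn.union_of_isClosed (hF.congr fun z hz => hkF z hz.1.2)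
          (hG.congr fun z hz => hkG z hz.1.1 hz.2) (isClosed_Icc.prod isClosed_Icc)
          (isClosed_Icc.prod isClosed_Icc)
      · rcases le_total z.1 (t n) with h' | h'
        · rw [hkF z h', hFh z ⟨⟨hz.1.1, h'⟩, hz.2⟩ hzA]
        · rw [hkG z h' hz.2, hGh z ⟨⟨h', hz.1.2⟩, hz.2⟩ hzA]
      · rw [hkG _ hle hy, hGn' y hy]
  obtain ⟨F, hF, hFh, -⟩ := key m
  rw [hm m le_rfl] at hF hFh
  refine ⟨F, hF, fun z hz => hFh z ?_ hz⟩
  rcases hz with hz | ⟨hz, hz'⟩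
  · exact ⟨hBpq hz.1, hz.2⟩
  · refine ⟨hz, ?_⟩
    rcases hz' with h' | h' <;> simp_all

/-- Adding an arc to a compact set preserves null-homotopy, in a simply connected space. -/
theorem NullHomotopicOn.union_image_Icc [T2Space X] [SimplyConnectedSpace X] [LocallyPlanar X]
    {Γ : Set X} (hΓ : IsClosed Γ) (hnull : NullHomotopicOn Γ) {α : ℝ → X} (hα : IsEmbedding α)
    {p q : ℝ} (hpq : p ≤ q) :
    NullHomotopicOn (Γ ∪ α '' Icc p q) := by
  classical
  obtain ⟨c, H, hH, hH0, hH1⟩ := hnull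
  let B : Set ℝ := Icc p q ∩ α ⁻¹' Γ
  let h : ℝ × ℝ → X := fun z => if α z.1 ∈ Γ then H (α z.1, z.2) else if z.2 = 0 then α z.1 else c
  have hh0 (s : ℝ) : h (s, 0) = α s := by
    by_cases hs : α s ∈ Γ <;> simp [h, hs, hH0]
  have hh1 (s : ℝ) : h (s, 1) = c := by
    by_cases hs : α s ∈ Γ <;> simp [h, hs, hH1]
  have hB : IsClosed B := isClosed_Icc.inter (hΓ.preimage hα.continuous)
  have hh : ContinuousOn h (B ×ˢ Icc 0 1 ∪ Icc p q ×ˢ {0, 1}) := by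
    rw [insert_eq, prod_union]
    have hs (t : ℝ) : IsClosed (Icc p q ×ˢ ({t} : Set ℝ)) := isClosed_Icc.prod isClosed_singleton
    refine ContinuousOn.union_of_isClosed ?_ (ContinuousOn.union_of_isClosed ?_ ?_ (hs 0) (hs 1))
      (hB.prod isClosed_Icc) ((hs 0).union (hs 1))
    · refine ContinuousOn.congr (hH.comp (f := fun z : ℝ × ℝ => (α z.1, z.2))
        (by have := hα.continuous; fun_prop)
        fun z hz => ⟨hz.1.2, hz.2⟩) fun z hz => if_pos hz.1.2
    · refine (hα.continuous.comp continuous_fst).continuousOn.congr ?_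
      rintro ⟨s, t⟩ ⟨-, rfl⟩
      exact hh0 s
    · refine (continuousOn_const (c := c)).congr ?_
      rintro ⟨s, t⟩ ⟨-, rfl⟩
      exact hh1 s
  obtain ⟨F, hF, hFh⟩ := exists_extension_Icc_prod hpq hB inter_subset_left hh
  have hleft : Function.LeftInverse (Function.invFun α) α :=
    Function.leftInverse_invFun hα.injective
  have hinv : ContinuousOn (Function.invFun α) (α '' Icc p q) := by
    rw [hα.isInducing.continuousOn_iff]
    refine continuousOn_id.congr ?_
    rintro _ ⟨s, -, rfl⟩
    exact congrArg α (hleft s)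
  let H' : X × ℝ → X := fun z => if z.1 ∈ Γ then H z else F (Function.invFun α z.1, z.2)
  have hH' (s y : ℝ) (hs : s ∈ Icc p q) (hy : y ∈ Icc (0 : ℝ) 1) : H' (α s, y) = F (s, y) := by
    by_cases hsΓ : α s ∈ Γ
    · rw [hFh (x := (s, y)) (.inl ⟨⟨hs, hsΓ⟩, hy⟩)]
      simp [H', h, hsΓ]
    · simp only [H', hsΓ, if_false]
      rw [hleft s]
  refine ⟨c, H', ?_, ?_, ?_⟩
  · rw [union_prod]
    refine ContinuousOn.union_of_isClosed (hH.congr fun z hz => if_pos hz.1) ?_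
      (hΓ.prod isClosed_Icc) ((isCompact_Icc.image hα.continuous).isClosed.prod isClosed_Icc)
    refine ContinuousOn.congr (hF.comp (f := fun z : X × ℝ => (Function.invFun α z.1, z.2))
      ((hinv.comp continuousOn_fst fun z hz => hz.1).prodMk continuousOn_snd) ?_) ?_
    · rintro ⟨_, y⟩ ⟨⟨s, hs, rfl⟩, hy⟩
      refine ⟨?_, hy⟩
      change Function.invFun α (α s) ∈ _
      rwa [hleft s]
    · rintro ⟨_, y⟩ ⟨⟨s, hs, rfl⟩, hy⟩
      simp only [Function.comp_apply]
      rw [hH' s y hs hy, hleft s]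
  · rintro x (hx | ⟨s, hs, rfl⟩)
    · simp [H', hx, hH0]
    · rw [hH' s 0 hs (by simp), hFh (.inr ⟨hs, by simp⟩), hh0]
  · rintro x (hx | ⟨s, hs, rfl⟩)
    · simp [H', hx, hH1]
    · rw [hH' s 1 hs (by simp), hFh (.inr ⟨hs, by simp⟩), hh1]

end SquareFilling

section NullHomotopic

variable {X : Type*} [TopologicalSpace X]

theorem NullHomotopicOn.mono {K L : Set X} (hL : NullHomotopicOn L) (hKL : K ⊆ L) :
    NullHomotopicOn K := by
  obtain ⟨c, H, hH, hH0, hH1⟩ := hL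
  exact ⟨c, H, hH.mono (prod_mono_left hKL), fun x hx => hH0 x (hKL hx), fun x hx => hH1 x (hKL hx)⟩

theorem nullHomotopicOn_of_homotopic {K : Set X} {g : C(K, X)} {c : X}
    (hg : ContinuousMap.Homotopic ⟨Subtype.val, continuous_subtype_val⟩ g)
    (hc : ContinuousMap.Homotopic g (.const K c)) : NullHomotopicOn K := by
  classical
  obtain ⟨H⟩ := hg.trans hc
  refine ⟨c, fun z => if hz : z.1 ∈ K then H (projIcc 0 1 zero_le_one z.2, ⟨z.1, hz⟩) else c,
    ?_, fun x hx => ?_, fun x hx => ?_⟩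
  · rw [continuousOn_iff_continuous_domRestrict]
    have : Continuous fun z : K ×ˢ Icc (0 : ℝ) 1 =>
        H (projIcc 0 1 zero_le_one z.1.2, ⟨z.1.1, z.2.1⟩) :=
      H.continuous.comp ((continuous_projIcc.comp (by fun_prop)).prodMk (by fun_prop))
    refine this.congr fun z => ?_
    simp [domRestrict_apply, z.2.1]
  · simp [hx]
  · simp [hx]

theorem sphere_zero_one_subset_sides : sphere (0 : ℝ × ℝ) 1 ⊆
    ((((fun s => (1, s)) '' Icc (-1) 1 ∪ (fun s => (-1, s)) '' Icc (-1) 1) ∪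
      (fun s => (s, 1)) '' Icc (-1) 1) ∪ (fun s => (s, -1)) '' Icc (-1 : ℝ) 1 : Set (ℝ × ℝ)) := by
  rintro ⟨x, y⟩ hz
  rw [mem_sphere_zero_iff_norm, Prod.norm_mk, Real.norm_eq_abs, Real.norm_eq_abs] at hz
  have hx := abs_le.1 (hz ▸ le_max_left |x| |y|)
  have hy := abs_le.1 (hz ▸ le_max_right |x| |y|)
  rcases max_choice |x| |y| with h | h <;> rw [h] at hz <;>
    rcases (abs_eq zero_le_one).1 hz with rfl | rfl <;> simp_all

theorem nullHomotopicOn_biUnion_sphere [T2Space X] [SimplyConnectedSpace X] [LocallyPlanar X]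
    {ι : Type*} {e : ι → ℝ × ℝ → X} (he : ∀ i, IsOpenEmbedding (e i)) (s : Finset ι) :
    NullHomotopicOn (⋃ i ∈ s, e i '' sphere 0 1) := by
  classical
  induction s using Finset.induction_on with
  | empty =>
    have c : X := Classical.choice inferInstance
    exact ⟨c, fun _ => c, continuousOn_const, by simp, by simp⟩
  | insert i s _ ih =>
    have hc : IsClosed (⋃ i ∈ s, e i '' sphere 0 1) :=
      (s.finite_toSet.isCompact_biUnion fun i _ =>
        (isCompact_sphere 0 1).image (he i).continuous).isClosed
    have hside (α : ℝ → ℝ × ℝ) (hα : IsEmbedding α) : IsEmbedding (e i ∘ α) :=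
      (he i).isEmbedding.comp hα
    have hclosed (α : ℝ → ℝ × ℝ) (hα : IsEmbedding α) : IsClosed ((e i ∘ α) '' Icc (-1) 1) :=
      (isCompact_Icc.image (hside α hα).continuous).isClosed
    have h1 (c : ℝ) : IsEmbedding fun s : ℝ => (c, s) := isEmbedding_prodMkRight c
    have h2 (c : ℝ) : IsEmbedding fun s : ℝ => (s, c) := isEmbedding_prodMkLeft c
    have hle : (-1 : ℝ) ≤ 1 := by norm_num
    refine NullHomotopicOn.mono ((((ih.union_image_Icc hc (hside _ (h1 1)) hle).union_image_Icc
      (hc.union (hclosed _ (h1 1))) (hside _ (h1 (-1))) hle).union_image_Icc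
      ((hc.union (hclosed _ (h1 1))).union (hclosed _ (h1 (-1)))) (hside _ (h2 1)) hle
      ).union_image_Icc (((hc.union (hclosed _ (h1 1))).union (hclosed _ (h1 (-1)))).union
        (hclosed _ (h2 1))) (hside _ (h2 (-1))) hle) ?_
    rw [Finset.set_biUnion_insert, union_comm]
    refine union_subset (fun x hx => .inl (.inl (.inl (.inl hx)))) ?_
    refine (image_mono sphere_zero_one_subset_sides).trans ?_
    simp only [image_union, ← image_comp]
    grind

/-- In a simply connected noncompact surface, every compact set is null-homotopic. -/
theorem nullHomotopicOn_of_isCompact [T2Space X] [SimplyConnectedSpace X] [LocallyPlanar X]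
    (hX : ¬ CompactSpace X) {K : Set X} (hK : IsCompact K) : NullHomotopicOn K := by
  classical
  choose e he he0 using LocallyPlanar.exists_chart (X := X)
  obtain ⟨t, -, ht⟩ := hK.elim_nhds_subcover (fun x => e x '' ball 0 1) fun x _ =>
    ((he x).isOpenMap _ isOpen_ball).mem_nhds ⟨0, by simp, he0 x⟩
  have hradius (i : X) : ∃ r ∈ Icc (1 : ℝ) 2, ∀ j ∈ t, ‖Function.invFun (e i) j‖ ≠ r := by
    obtain ⟨r, hr, hrt⟩ := (Icc_infinite (show (1 : ℝ) < 2 by norm_num)).exists_notMem_finset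
      (t.image fun j => ‖Function.invFun (e i) j‖)
    exact ⟨r, hr, fun j hj hjr => hrt (Finset.mem_image.2 ⟨j, hj, hjr⟩)⟩
  choose r hr hrt using hradius
  have hr0 (i : X) : 0 < r i := by linarith [(hr i).1]
  let e' : t → ℝ × ℝ → X := fun i z => e i (r i • z)
  have he' (i : t) : IsOpenEmbedding (e' i) :=
    LocallyPlanar.isOpenEmbedding_smul (he i) (hr0 i).ne'
  have he'0 (i : t) : e' i 0 = i := by simp [e', he0]
  have hsphere (i j : t) : e' i 0 ∉ e' j '' sphere 0 1 := by
    rintro ⟨z, hz, hzi⟩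
    rw [he'0] at hzi
    refine hrt j i i.2 ?_
    rw [← hzi, Function.leftInverse_invFun (he j).injective, norm_smul,
      mem_sphere_zero_iff_norm.1 hz, mul_one, Real.norm_of_nonneg (hr0 j).le]
  have hW : IsOpen (⋃ i, e' i '' ball 0 1) :=
    isOpen_iUnion fun i => (he' i).isOpenMap _ isOpen_ball
  have hKW : K ⊆ ⋃ i, e' i '' ball 0 1 := by
    intro x hx
    obtain ⟨i, hi, z, hz, rfl⟩ := mem_iUnion₂.1 (ht hx)
    refine mem_iUnion.2 ⟨⟨i, hi⟩, (r i)⁻¹ • z, ?_, ?_⟩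
    · rw [mem_ball_zero_iff] at hz ⊢
      rw [norm_smul, norm_inv, Real.norm_of_nonneg (hr0 i).le]
      exact (mul_le_of_le_one_left (norm_nonneg z) (inv_le_one_of_one_le₀ (hr i).1)).trans_lt hz
    · simp [e', smul_smul, (hr0 i).ne']
  obtain ⟨ψ, hψ, hψK⟩ := exists_homotopic_id_image_subset_diff hX hW hK hKW
    (finite_range fun i : t => e' i 0)
  let incl : C(K, X) := ⟨Subtype.val, continuous_subtype_val⟩
  have hmem (y : K) : ψ y ∈ (⋃ i, e' i '' ball 0 1) \ range fun i : t => e' i 0 :=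
    hψK ⟨y, y.2, rfl⟩
  obtain ⟨g, hfg, hg⟩ := exists_homotopic_mem_iUnion_sphere he' hsphere (ψ.comp incl)
    (fun y => mem_iUnion.1 (hmem y).1) fun y i h => (hmem y).2 ⟨i, h.symm⟩
  obtain ⟨c, H, hH, hH0, hH1⟩ := nullHomotopicOn_biUnion_sphere he' Finset.univ
  have hgΓ (y : K) : g y ∈ ⋃ i ∈ Finset.univ, e' i '' sphere 0 1 := by simpa using hg y
  refine nullHomotopicOn_of_homotopic (((hψ.comp (.refl incl)).trans hfg)) (c := c) ⟨?_⟩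
  exact
    { toFun := fun z => H (g z.2, z.1)
      continuous_toFun := hH.comp_continuous (by fun_prop) fun z => ⟨hgΓ z.2, z.1.2⟩
      map_zero_left := fun y => hH0 _ (hgΓ y)
      map_one_left := fun y => hH1 _ (hgΓ y) }

end NullHomotopic

section UniversalCover

open unitInterval

/-- The discrete topology on the set of homotopy classes of loops at a point. -/
abbrev discreteLoopClass {S : Type*} [TopologicalSpace S] (a : S) :
    TopologicalSpace (Path.Homotopic.Quotient a a) := ⊥

attribute [local instance] discreteLoopClass

instance {S : Type*} [TopologicalSpace S] (a : S) :
    DiscreteTopology (Path.Homotopic.Quotient a a) := ⟨rfl⟩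

/-- An open cover together with path classes from the points of each member to the base point,
which are compatible with the paths contained in that member. -/
structure PathTrivialization (S : Type*) [TopologicalSpace S] (a : S) where
  /-- The neighbourhood of a point. -/
  nhd : S → Set S
  isOpen_nhd : ∀ i, IsOpen (nhd i)
  mem_nhd : ∀ i, i ∈ nhd i
  /-- The path class from a point of the neighbourhood to the base point. -/
  toBase : ∀ _ x : S, Path.Homotopic.Quotient x a
  mk_trans_toBase : ∀ (i : S) {x y : S} (κ : Path x y), (∀ t, κ t ∈ nhd i) →
    (Path.Homotopic.Quotient.mk κ).trans (toBase i y) = toBase i x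

theorem Path.homotopic_of_mem_range {X S : Type*} [TopologicalSpace X] [TopologicalSpace S]
    [SimplyConnectedSpace X] {e : X → S} (he : IsEmbedding e) {x y : S} (κ κ' : Path x y)
    (hκ : ∀ t, κ t ∈ range e) (hκ' : ∀ t, κ' t ∈ range e) : κ.Homotopic κ' := by
  obtain ⟨u, rfl⟩ : x ∈ range e := by simpa using hκ 0
  obtain ⟨v, rfl⟩ : y ∈ range e := by simpa using hκ 1
  have hlift (κ : Path (e u) (e v)) (hκ : ∀ t, κ t ∈ range e) :
      ∃ δ : Path u v, κ = δ.map he.continuous := by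
    choose δ hδ using hκ
    refine ⟨⟨⟨δ, ?_⟩, he.injective (by simp [hδ]), he.injective (by simp [hδ])⟩, ?_⟩
    · rw [he.continuous_iff]
      exact κ.continuous.congr fun t => (hδ t).symm
    · ext t
      exact (hδ t).symm
  obtain ⟨δ, rfl⟩ := hlift κ hκ
  obtain ⟨δ', rfl⟩ := hlift κ' hκ'
  exact (SimplyConnectedSpace.paths_homotopic δ δ').map ⟨e, he.continuous⟩

theorem PathTrivialization.nonempty_of_locallyPlanar {S : Type*} [TopologicalSpace S]
    [LocallyPlanar S] [PathConnectedSpace S] (a : S) : Nonempty (PathTrivialization S a) := by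
  classical
  choose e he he0 using LocallyPlanar.exists_chart (X := S)
  have hpath (i x : S) : ∃ κ : Path x i, x ∈ range (e i) → ∀ t, κ t ∈ range (e i) := by
    by_cases hx : x ∈ range (e i)
    · have := (isPathConnected_range (he i).continuous).joinedIn x hx i ⟨0, he0 i⟩
      exact ⟨this.somePath, fun _ => this.somePath_mem⟩
    · exact ⟨PathConnectedSpace.somePath x i, fun h => (hx h).elim⟩
  choose δ hδ using hpath
  refine ⟨⟨fun i => range (e i), fun i => (he i).isOpen_range, fun i => ⟨0, he0 i⟩,
    fun i x => .mk ((δ i x).trans (PathConnectedSpace.somePath i a)), ?_⟩⟩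
  intro i x y κ hκ
  have hx : x ∈ range (e i) := by simpa using hκ 0
  have hy : y ∈ range (e i) := by simpa using hκ 1
  rw [Path.Homotopic.Quotient.mk_trans, ← Path.Homotopic.Quotient.trans_assoc,
    ← Path.Homotopic.Quotient.mk_trans, Path.Homotopic.Quotient.mk_trans (δ i x)]
  congr 1
  refine Path.Homotopic.Quotient.eq.2 (Path.homotopic_of_mem_range (he i).isEmbedding _ _
    (fun t => ?_) (hδ i x hx))
  rw [Path.trans_apply]
  split_ifs
  exacts [hκ _, hδ i y hy _]

namespace PathTrivialization

variable {S : Type*} [TopologicalSpace S] {a : S} (T : PathTrivialization S a)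

theorem eventually_toBase_symm_trans [LocallyPathConnectedSpace S] {i j x : S} (hi : x ∈ T.nhd i)
    (hj : x ∈ T.nhd j) : ∀ᶠ y in 𝓝 x, (T.toBase i y).symm.trans (T.toBase j y) =
      (T.toBase i x).symm.trans (T.toBase j x) := by
  obtain ⟨U, ⟨hUx, hU⟩, hUij⟩ := (path_connected_basis x).mem_iff.1
    (((T.isOpen_nhd i).inter (T.isOpen_nhd j)).mem_nhds ⟨hi, hj⟩)
  filter_upwards [hUx] with y hy
  obtain ⟨κ, hκ⟩ := hU.joinedIn x (mem_of_mem_nhds hUx) y hy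
  rw [← T.mk_trans_toBase i κ fun t => (hUij (hκ t)).1,
    ← T.mk_trans_toBase j κ fun t => (hUij (hκ t)).2]
  generalize T.toBase i y = p
  generalize T.toBase j y = q
  induction p using Path.Homotopic.Quotient.ind
  rw [← Path.Homotopic.Quotient.mk_trans, ← Path.Homotopic.Quotient.mk_symm,
    ← Path.Homotopic.Quotient.mk_symm, Path.trans_symm, Path.Homotopic.Quotient.mk_trans,
    Path.Homotopic.Quotient.mk_symm κ, Path.Homotopic.Quotient.trans_assoc]
  congr 1
  rw [← Path.Homotopic.Quotient.trans_assoc]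
  simp

/-- The bundle over `S` whose fibre at `x` is the set of path classes from `a` to `x`, read
through the trivialization. -/
noncomputable def core [LocallyPathConnectedSpace S] :
    FiberBundleCore S S (Path.Homotopic.Quotient a a) where
  baseSet := T.nhd
  isOpen_baseSet := T.isOpen_nhd
  indexAt := id
  mem_baseSet_at := T.mem_nhd
  coordChange i j x v := v.trans ((T.toBase i x).symm.trans (T.toBase j x))
  coordChange_self i x _ v := by simp
  continuousOn_coordChange i j := by
    rintro ⟨x, v⟩ ⟨⟨hi, hj⟩, -⟩
    refine ContinuousAt.continuousWithinAt (ContinuousAt.congr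
      ((continuous_of_discreteTopology (f := fun v : Path.Homotopic.Quotient a a =>
        v.trans ((T.toBase i x).symm.trans (T.toBase j x)))).comp continuous_snd).continuousAt ?_)
    filter_upwards [continuousAt_fst.preimage_mem_nhds
      (T.eventually_toBase_symm_trans hi hj)] with p hp
    rw [hp]
    rfl
  coordChange_comp i j k x _ v := by
    rw [Path.Homotopic.Quotient.trans_assoc]
    congr 1
    rw [Path.Homotopic.Quotient.trans_assoc]
    congr 1
    rw [← Path.Homotopic.Quotient.trans_assoc]
    simp

variable [LocallyPathConnectedSpace S]

/-- The path class from the base point represented by a point of the total space. -/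
noncomputable def pathClass (y : T.core.TotalSpace) : Path.Homotopic.Quotient a y.1 :=
  Path.Homotopic.Quotient.trans y.2 (T.toBase y.1 y.1).symm

theorem localTriv_snd (i : S) (y : T.core.TotalSpace) :
    (T.core.localTriv i y).2 = (T.pathClass y).trans (T.toBase i y.1) :=
  (Path.Homotopic.Quotient.trans_assoc _ _ _).symm

theorem pathClass_injective {x : S} {v w : T.core.Fiber x}
    (h : T.pathClass ⟨x, v⟩ = T.pathClass ⟨x, w⟩) : v = w := by
  have hv (v : Path.Homotopic.Quotient a a) :
      (T.pathClass ⟨x, v⟩).trans (T.toBase x x) = v := by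
    rw [pathClass, Path.Homotopic.Quotient.trans_assoc]
    simp
  exact (hv v).symm.trans ((congrArg (Path.Homotopic.Quotient.trans · _) h).trans (hv w))

theorem pathClass_eq_trans {y₀ y₁ : T.core.TotalSpace} (Γ : Path y₀ y₁) (κ : Path y₀.1 y₁.1)
    (hκ : ∀ t, κ t = (Γ t).1) : T.pathClass y₁ = (T.pathClass y₀).trans (.mk κ) := by
  let k (s t : I) : Path.Homotopic.Quotient (κ s) (κ t) := .mk (κ.subpath s t)
  have hk (s t u : I) : (k s t).trans (k t u) = k s u :=
    (Path.Homotopic.Quotient.mk_trans _ _).symm.trans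
      (Path.Homotopic.Quotient.eq.2 ⟨Path.Homotopy.subpathTransSubpath κ s t u⟩)
  have hk0 (t : I) : k t t = .refl _ := by simp [k]
  let φ (t : I) : Path.Homotopic.Quotient a (κ t) := (T.pathClass (Γ t)).cast rfl (hκ t)
  have hlocal (s : I) : ∀ᶠ t in 𝓝 s, φ t = (φ s).trans (k s t) := by
    let i := κ s
    have hs : (Γ s).1 ∈ T.nhd i := by rw [← hκ]; exact T.mem_nhd _
    have hcont : ContinuousAt (fun t => (T.core.localTriv i (Γ t)).2) s := by
      have h1 := (T.core.localTriv i).continuousOn.continuousAt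
        ((T.core.localTriv i).open_source.mem_nhds ((T.core.mem_localTriv_source i _).2 hs))
      exact (continuousAt_snd.comp h1).comp Γ.continuous.continuousAt
    have hev : ∀ᶠ t in 𝓝 s, κ t ∈ T.nhd i :=
      κ.continuous.continuousAt.preimage_mem_nhds ((T.isOpen_nhd i).mem_nhds (T.mem_nhd i))
    have hev' := (tendsto_const_nhds.uIcc tendsto_id).eventually
      (eventually_smallSets_forall.2 hev)
    filter_upwards [hcont.preimage_mem_nhds ((isOpen_discrete {_}).mem_nhds rfl), hev']
      with t ht ht'
    have hcast {x x' : S} (h : x' = x) (p : Path.Homotopic.Quotient a x) :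
        (p.cast rfl h).trans (T.toBase i x') = p.trans (T.toBase i x) := by
      subst h
      simp
    have hφ : (φ t).trans (T.toBase i (κ t)) = (φ s).trans (T.toBase i (κ s)) := by
      rw [hcast, hcast, ← T.localTriv_snd, ← T.localTriv_snd]
      exact ht
    rw [← T.mk_trans_toBase i (κ.subpath s t) fun u => ht' _ ?_,
      ← Path.Homotopic.Quotient.trans_assoc] at hφ
    · have := congrArg (Path.Homotopic.Quotient.trans · (T.toBase i (κ t)).symm) hφ
      simpa only [Path.Homotopic.Quotient.trans_assoc, Path.Homotopic.Quotient.trans_symm,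
        Path.Homotopic.Quotient.trans_refl] using this
    · exact (Path.range_subpathAux s t).subset ⟨u, rfl⟩
  let f (t : I) : Path.Homotopic.Quotient a (κ 0) := (φ t).trans (k t 0)
  have hf : IsLocallyConstant f := by
    refine (IsLocallyConstant.iff_eventually_eq f).2 fun s => ?_
    filter_upwards [hlocal s] with t ht
    simp only [f]
    rw [ht, Path.Homotopic.Quotient.trans_assoc, hk]
  have hf1 : f 1 = f 0 := hf.apply_eq_of_preconnectedSpace 1 0
  have hφ : φ 1 = (φ 0).trans (k 0 1) := by
    have := congrArg (fun p => p.trans (k 0 1)) hf1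
    simpa only [f, Path.Homotopic.Quotient.trans_assoc, hk, hk0,
      Path.Homotopic.Quotient.trans_refl] using this
  have hend (t : I) (y : T.core.TotalSpace) (hy : Γ t = y) (h : κ t = y.1) :
      φ t = (T.pathClass y).cast rfl h := by
    subst hy
    rfl
  have hk01 : k 0 1 = (Path.Homotopic.Quotient.mk κ).cast κ.source κ.target := by
    simp only [k, Path.subpath_zero_one, Path.Homotopic.Quotient.mk_cast]
  rw [hend 1 y₁ Γ.target κ.target, hend 0 y₀ Γ.source κ.source, hk01] at hφ
  have huncast {x₀ x₁ x₀' x₁' : S} (h₀ : x₀' = x₀) (h₁ : x₁' = x₁)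
      (p : Path.Homotopic.Quotient a x₁) (q : Path.Homotopic.Quotient a x₀)
      (r : Path.Homotopic.Quotient x₀ x₁)
      (h : p.cast rfl h₁ = (q.cast rfl h₀).trans (r.cast h₀ h₁)) : p = q.trans r := by
    subst h₀ h₁
    simpa using h
  exact huncast _ _ _ _ _ hφ

theorem isCoveringMap_proj : IsCoveringMap T.core.proj :=
  FiberBundle.isCoveringMap

theorem simplyConnectedSpace_totalSpace [PathConnectedSpace S] :
    SimplyConnectedSpace T.core.TotalSpace := by
  have hcov := T.isCoveringMap_proj
  rw [simply_connected_iff_loops_nullhomotopic]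
  constructor
  · let y₀ : T.core.TotalSpace := ⟨a, T.toBase a a⟩
    have hy₀ : T.pathClass y₀ = .refl a := by simp [pathClass, y₀]
    refine pathConnectedSpace_iff_eq.2 ⟨y₀, eq_univ_of_forall fun y => ?_⟩
    obtain ⟨x, v⟩ := y
    obtain ⟨κ, hκ⟩ := Path.Homotopic.Quotient.mk_surjective (T.pathClass ⟨x, v⟩)
    obtain ⟨Γ, hΓ, hΓ0⟩ := hcov.exists_path_lifts κ y₀ κ.source
    have h1 : T.core.proj (Γ 1) = x := (congrFun hΓ 1).trans κ.target
    generalize hy : Γ 1 = y₁ at h1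
    obtain ⟨x', v'⟩ := y₁
    change x' = x at h1
    subst h1
    let Γ' : Path y₀ ⟨x', v'⟩ := ⟨Γ, hΓ0, hy⟩
    have h := T.pathClass_eq_trans Γ' κ fun t => (congrFun hΓ t).symm
    rw [hy₀, hκ, Path.Homotopic.Quotient.refl_trans] at h
    rw [← T.pathClass_injective h]
    exact ⟨Γ'⟩
  · intro y Γ
    have h := T.pathClass_eq_trans Γ (Γ.map T.core.continuous_proj) fun _ => rfl
    have h' := congrArg (Path.Homotopic.Quotient.trans (T.pathClass y).symm) h
    rw [← Path.Homotopic.Quotient.trans_assoc, Path.Homotopic.Quotient.symm_trans,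
      Path.Homotopic.Quotient.refl_trans] at h'
    exact Path.Homotopic.Quotient.eq.1 (hcov.injective_path_homotopic_map y y h'.symm)

end PathTrivialization

theorem exists_simplyConnected_covering.{u} (S : Type u) [TopologicalSpace S] [LocallyPlanar S]
    [PathConnectedSpace S] : ∃ (E : Type u) (_ : TopologicalSpace E) (p : E → S),
      IsCoveringMap p ∧ SimplyConnectedSpace E := by
  obtain ⟨T⟩ := PathTrivialization.nonempty_of_locallyPlanar (Classical.arbitrary S)
  exact ⟨T.core.TotalSpace, inferInstance, T.core.proj, T.isCoveringMap_proj,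
    T.simplyConnectedSpace_totalSpace⟩

end UniversalCover

section CoveringSpace

open unitInterval

variable {E S : Type*} [TopologicalSpace E] [TopologicalSpace S] {p : E → S}

theorem IsCoveringMap.t2Space [T2Space S] (hp : IsCoveringMap p) : T2Space E := by
  refine ⟨fun x y hxy => ?_⟩
  by_cases h : p x = p y
  · exact hp.isSeparatedMap x y h hxy
  · exact separated_by_continuous hp.continuous h

theorem IsCoveringMap.locallyPlanar [LocallyPlanar S] (hp : IsCoveringMap p) :
    LocallyPlanar E := by
  refine ⟨fun x => ?_⟩
  obtain ⟨e, he, he0⟩ := LocallyPlanar.exists_chart (p x)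
  obtain ⟨F, ⟨hF0, hF⟩, -⟩ :=
    hp.existsUnique_continuousMap_lifts ⟨e, he.continuous⟩ 0 x he0.symm
  refine ⟨F, ?_, hF0⟩
  refine hp.isLocalHomeomorph.isOpenEmbedding_of_comp ?_ F.continuous
  rw [hF]
  exact he

theorem IsCoveringMap.surjective [PathConnectedSpace S] [Nonempty E] (hp : IsCoveringMap p) :
    Function.Surjective p := by
  intro x
  let y : E := Classical.arbitrary E
  let κ := PathConnectedSpace.somePath (p y) x
  obtain ⟨Γ, hΓ, -⟩ := hp.exists_path_lifts κ y κ.source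
  exact ⟨Γ 1, (congrFun hΓ 1).trans κ.target⟩

theorem IsCoveringMap.lindelofSpace [SecondCountableTopology S] [PathConnectedSpace E]
    (hp : IsCoveringMap p) : LindelofSpace E := by
  let y : E := Classical.arbitrary E
  let A : Set C(I, S) := {κ | κ 0 = p y}
  let H : C(I × A, S) := ⟨fun q => (q.2 : C(I, S)) q.1, by fun_prop⟩
  let L : C(I × A, E) := hp.liftHomotopy H (.const A y) fun κ => κ.2
  have hsurj : Function.Surjective fun κ : A => L (1, κ) := by
    intro z
    let Γ := PathConnectedSpace.somePath y z
    let κ : A := ⟨⟨p ∘ Γ, hp.continuous.comp Γ.continuous⟩, congrArg p Γ.source⟩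
    refine ⟨κ, ?_⟩
    have : (Γ : I → E) = fun t => L (t, κ) := by
      refine hp.eq_of_comp_eq Γ.continuous (by fun_prop) ?_ 0 ?_
      · ext t
        exact (congrFun (hp.liftHomotopy_lifts H (.const A y) fun κ => κ.2) (t, κ)).symm
      · exact Γ.source.trans (hp.liftHomotopy_zero H (.const A y) (fun κ => κ.2) κ).symm
    exact (congrFun this 1).symm.trans Γ.target
  have hcont : Continuous fun κ : A => L (1, κ) := by fun_prop
  rw [← isLindelof_univ_iff, ← hsurj.range_eq]
  exact isLindelof_range hcont

theorem sigmaCompactSpace_of_lindelofSpace (X : Type*) [TopologicalSpace X] [LindelofSpace X]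
    [LocallyCompactSpace X] : SigmaCompactSpace X := by
  choose K hK hKx using exists_compact_mem_nhds (X := X)
  obtain ⟨t, ht, hcov⟩ := countable_cover_nhds hKx
  exact SigmaCompactSpace.of_countable (K '' t) (ht.image K) (by rintro _ ⟨x, -, rfl⟩; exact hK x)
    (by rw [sUnion_image]; exact hcov)

/-- A noncompact surface has a covering space that contracts to a point. -/
theorem exists_contractible_covering.{u} (S : Type u) [TopologicalSpace S] [T2Space S]
    [SecondCountableTopology S] [LocallyPlanar S] [PathConnectedSpace S]
    (hS : ¬ CompactSpace S) : ∃ (E : Type u) (_ : TopologicalSpace E) (p : E → S),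
      IsCoveringMap p ∧ Function.Surjective p ∧ ∃ c, ∃ H : C(E × I, E),
        (∀ x, H (x, 0) = x) ∧ ∀ x, H (x, 1) = c := by
  obtain ⟨E, _, p, hp, hE⟩ := exists_simplyConnected_covering S
  have := hp.t2Space
  have := hp.locallyPlanar
  have := hp.lindelofSpace
  have := sigmaCompactSpace_of_lindelofSpace E
  have hsurj := hp.surjective
  refine ⟨E, _, p, hp, hsurj, contractibleSpace_of_nullHomotopicOn fun K hK =>
    nullHomotopicOn_of_isCompact (fun h => hS ?_) hK⟩
  exact hsurj.compactSpace hp.continuous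

end CoveringSpace

section PathSpace

open unitInterval

/-- A reparametrization of the square: for `q.1 = 0` it is `s ↦ (s, 0)`, and for `q.1 = 1` it runs
along three sides of the square, through the side of points with second coordinate `1`. -/
noncomputable def squareSlide (q : I × I) : I × I :=
  (projIcc 0 1 zero_le_one ((1 - q.1 : ℝ) * q.2 + q.1 * (3 * q.2 - 1)),
    projIcc 0 1 zero_le_one ((q.1 : ℝ) * min (3 * q.2 : ℝ) (3 - 3 * q.2)))

theorem continuous_squareSlide : Continuous squareSlide := by
  unfold squareSlide
  exact (continuous_projIcc.comp (by fun_prop)).prodMk (continuous_projIcc.comp (by fun_prop))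

theorem squareSlide_zero_left (s : I) : squareSlide (0, s) = (s, 0) := by
  simp [squareSlide]

theorem squareSlide_zero_right (τ : I) : squareSlide (τ, 0) = (0, 0) := by
  refine Prod.ext (projIcc_of_le_left zero_le_one ?_) (projIcc_of_le_left zero_le_one ?_) <;>
    simp [τ.2.1]

theorem squareSlide_one_right (τ : I) : squareSlide (τ, 1) = (1, 0) := by
  refine Prod.ext (projIcc_of_right_le zero_le_one ?_) (projIcc_of_le_left zero_le_one ?_)
  · have := τ.2.1
    norm_num
    linarith
  · norm_num

theorem squareSlide_one_left (s : I) : (squareSlide (1, s)).1 = 0 ∨ (squareSlide (1, s)).1 = 1 ∨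
    (squareSlide (1, s)).2 = 1 := by
  rcases le_total (3 * (s : ℝ)) 1 with h | h
  · exact .inl (projIcc_of_le_left zero_le_one (by norm_num; linarith))
  rcases le_total (3 * (s : ℝ)) 2 with h' | h'
  · refine .inr (.inr (projIcc_of_right_le zero_le_one ?_))
    norm_num
    constructor <;> linarith
  · exact .inr (.inl (projIcc_of_right_le zero_le_one (by norm_num; linarith)))

theorem contractibleSpace_pathComponent_of_covering {E S : Type*} [TopologicalSpace E]
    [TopologicalSpace S] {p : E → S} (hp : IsCoveringMap p) (hsurj : Function.Surjective p)
    {c : E} (C : C(E × I, E)) (hC0 : ∀ x, C (x, 0) = x) (hC1 : ∀ x, C (x, 1) = c)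
    {a b : S} (γ : Path a b) : ContractibleSpace (pathComponent γ) := by
  have : PathConnectedSpace (pathComponent γ) :=
    isPathConnected_iff_pathConnectedSpace.1 isPathConnected_pathComponent
  obtain ⟨a', ha'⟩ := hsurj a
  let ev : C(I × pathComponent γ, S) := ⟨fun q => (q.2 : Path a b) q.1, by fun_prop⟩
  have hev0 (β : pathComponent γ) : ev (0, β) = p (ContinuousMap.const _ a' β) :=
    (β : Path a b).source.trans ha'.symm
  obtain ⟨L, hL, hL0⟩ : ∃ L : C(I × pathComponent γ, E),
      (∀ t β, p (L (t, β)) = (β : Path a b) t) ∧ ∀ β, L (0, β) = a' :=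
    ⟨hp.liftHomotopy ev (.const _ a') hev0,
      fun t β => congrFun (hp.liftHomotopy_lifts ev (.const _ a') hev0) (t, β),
      hp.liftHomotopy_zero ev (.const _ a') hev0⟩
  have hL1 (β β' : pathComponent γ) : L (1, β) = L (1, β') :=
    hp.const_of_comp (g := fun β => L (1, β)) (by fun_prop) (fun β β' => by simp [hL]) β β'
  obtain ⟨M, hM, hM0, hM1, hMa, hMb⟩ : ∃ M : I → pathComponent γ → I → E,
      Continuous (fun q : (I × pathComponent γ) × I => M q.1.1 q.1.2 q.2) ∧
      (∀ β s, M 0 β s = L (s, β)) ∧ (∀ β β' s, M 1 β s = M 1 β' s) ∧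
      (∀ τ β, p (M τ β 0) = a) ∧ ∀ τ β, p (M τ β 1) = b := by
    refine ⟨fun τ β s => C (L ((squareSlide (τ, s)).1, β), (squareSlide (τ, s)).2), ?_,
      fun β s => ?_, fun β β' s => ?_, fun τ β => ?_, fun τ β => ?_⟩ <;> beta_reduce
    · have := continuous_squareSlide
      fun_prop
    · rw [squareSlide_zero_left, hC0]
    · rcases squareSlide_one_left s with h | h | h
      · rw [h, hL0, hL0]
      · rw [h, hL1 β β']
      · rw [h, hC1, hC1]
    · rw [squareSlide_zero_right, hC0, hL0, ha']
    · rw [squareSlide_one_right, hC0, hL, Path.target]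
  let G (q : I × pathComponent γ) : Path a b :=
    { toFun := fun s => p (M q.1 q.2 s)
      continuous_toFun := hp.continuous.comp (hM.comp (Continuous.prodMk_right q))
      source' := hMa q.1 q.2
      target' := hMb q.1 q.2 }
  have hG : Continuous G := Path.continuous_uncurry_iff.1 (hp.continuous.comp hM)
  have hG0 (β : pathComponent γ) : G (0, β) = β := by
    ext s
    exact (congrArg p (hM0 β s)).trans (hL s β)
  have hmem (q : I × pathComponent γ) : G q ∈ pathComponent γ := by
    have hj : Joined (G (0, q.2)) (G q) :=
      ⟨⟨⟨fun t => G (t * q.1, q.2), by fun_prop⟩, by simp, by simp⟩⟩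
    rw [hG0] at hj
    exact Joined.trans q.2.2 hj
  let β₀ : pathComponent γ := ⟨γ, mem_pathComponent_self γ⟩
  refine (contractible_iff_id_nullhomotopic _).2 ⟨⟨G (1, β₀), hmem _⟩, ⟨⟨⟨fun q => ⟨G q, hmem q⟩,
    hG.subtype_mk _⟩, fun β => Subtype.ext (hG0 β), fun β => Subtype.ext ?_⟩⟩⟩
  ext s
  exact congrArg p (hM1 β β₀ s)

theorem locallyPlanar_of_chartedSpace (S : Type*) [TopologicalSpace S]
    [ChartedSpace (EuclideanSpace ℝ (Fin 2)) S] : LocallyPlanar S := by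
  refine ⟨fun x => ?_⟩
  let φ := chartAt (EuclideanSpace ℝ (Fin 2)) x
  obtain ⟨r, hr, hball⟩ := Metric.mem_nhds_iff.1
    (φ.open_target.mem_nhds (φ.map_source (mem_chart_source _ x)))
  let u := OpenPartialHomeomorph.univBall (φ x) r
  let ψ := u.trans φ.symm
  have hψ : ψ.source = univ := by
    refine eq_univ_of_forall fun y => ⟨by simp [u], hball ?_⟩
    rw [← OpenPartialHomeomorph.univBall_target (φ x) hr]
    exact u.map_source (by simp [u])
  let L : (ℝ × ℝ) ≃L[ℝ] EuclideanSpace ℝ (Fin 2) :=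
    ContinuousLinearEquiv.ofFinrankEq (by simp)
  refine ⟨ψ ∘ L, (ψ.isOpenEmbedding hψ).comp L.toHomeomorph.isOpenEmbedding, ?_⟩
  simp only [Function.comp_apply, map_zero, ψ, u, OpenPartialHomeomorph.coe_trans,
    OpenPartialHomeomorph.univBall_apply_zero]
  exact φ.left_inv (mem_chart_source _ x)

end PathSpace

/-- let `S` be a connected, noncompact topological 2-manifold (Hausdorff,
second countable, locally homeomorphic to `ℝ²`, without boundary) and let `a, b ∈ S`.
Then every path component of the space of continuous paths in `S` from `a` to `b`
(with the compact-open topology) is contractible. -/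
theorem stmt_16 (S : Type*) [TopologicalSpace S] [T2Space S] [SecondCountableTopology S]
    [ChartedSpace (EuclideanSpace ℝ (Fin 2)) S] [ConnectedSpace S]
    (hnc : ¬ CompactSpace S) (a b : S) (γ : Path a b) :
    ContractibleSpace (pathComponent γ) := by
  have := locallyPlanar_of_chartedSpace S
  have : PathConnectedSpace S := pathConnectedSpace_iff_connectedSpace.2 inferInstance
  obtain ⟨E, _, p, hp, hsurj, c, C, hC0, hC1⟩ := exists_contractible_covering S hnc
  exact contractibleSpace_pathComponent_of_covering hp hsurj C hC0 hC1 γ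
end
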